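/- arXiv:2108.13566 — 2 statements merged into one kernel-verified Lean document; each statement's English description precedes it below -/
import Mathlib

section
/- Let m ≥ 1, and set H := ℝ^m × [0,∞) and H₁ := ℝ^m × [0,1] inside ℝ^m × ℝ. Let i : ℝ^m × ℝ → ℝ^{m+1} be infinitely differentiable such that its restriction to H is injective, proper, and has injective Fréchet derivative at every point of H. Let j : ℝ^m × ℝ → ℝ^{m+1} be infinitely differentiable such that j(x, 0) = i(x, 0) for all x, the restriction of j to H₁ is injective, proper, and has injective Fréchet derivative at every point of H₁, j(H₁) ⊆ i(H), and j(ℝ^m × [0,1)) is an open subset of i(H) in the subspace topology (so j is a collar neighborhood of i(ℝ^m × {0}) inside i(H) agreeing with i on ℝ^m × {0}). Then there exists an infinitely differentiable map i' : ℝ^m × ℝ → ℝ^{m+1} whose restriction to H is injective, proper, and has injective Fréchet derivative at every point of H, with i'(H) = i(H), and such that for some ε > 0 one has i'(x, t) = j(x, t) whenever 0 ≤ t ≤ ε. -/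
namespace CollarAux

open Set Filter Topology

/-- `f` is a smooth diffeomorphism from `U` to `V`, with inverse `g`. -/
structure Dif {X Y : Type*} [NormedAddCommGroup X] [NormedSpace ℝ X] [NormedAddCommGroup Y]
    [NormedSpace ℝ Y] (U : Set X) (V : Set Y) (f : X → Y) (g : Y → X) : Prop where
  cf : ContDiffOn ℝ (⊤ : ℕ∞) f U
  cg : ContDiffOn ℝ (⊤ : ℕ∞) g V
  mf : MapsTo f U V
  mg : MapsTo g V U
  li : ∀ x ∈ U, g (f x) = x
  ri : ∀ y ∈ V, f (g y) = y

section
variable {X Y Z : Type*} [NormedAddCommGroup X] [NormedSpace ℝ X] [NormedAddCommGroup Y]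
    [NormedSpace ℝ Y] [NormedAddCommGroup Z] [NormedSpace ℝ Z]

theorem Dif.symm {U : Set X} {V : Set Y} {f : X → Y} {g : Y → X} (h : Dif U V f g) :
    Dif V U g f := ⟨h.cg, h.cf, h.mg, h.mf, h.ri, h.li⟩

theorem Dif.comp {U : Set X} {V : Set Y} {W : Set Z} {f : X → Y} {g : Y → X}
    {f' : Y → Z} {g' : Z → Y} (h' : Dif V W f' g') (h : Dif U V f g) :
    Dif U W (f' ∘ f) (g ∘ g') :=
  ⟨h'.cf.comp h.cf h.mf, h.cg.comp h'.cg h'.mg, h'.mf.comp h.mf, h.mg.comp h'.mg,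
    fun x hx => by simp [h'.li _ (h.mf hx), h.li x hx],
    fun x hx => by simp [h.ri _ (h'.mg hx), h'.ri x hx]⟩

theorem Dif.congr {U : Set X} {V : Set Y} {f f' : X → Y} {g : Y → X} (h : Dif U V f g)
    (hf : ∀ x ∈ U, f' x = f x) : Dif U V f' g :=
  ⟨h.cf.congr hf, h.cg, fun x hx => by rw [hf x hx]; exact h.mf hx, h.mg,
    fun x hx => by rw [hf x hx]; exact h.li x hx,
    fun y hy => by rw [hf _ (h.mg hy)]; exact h.ri y hy⟩

theorem Dif.fderiv_inj {U : Set X} {V : Set Y} {f : X → Y} {g : Y → X} (h : Dif U V f g)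
    (hU : IsOpen U) (hV : IsOpen V) {x : X} (hx : x ∈ U) :
    Function.Injective (fderiv ℝ f x) := by
  have h1 : HasFDerivAt f (fderiv ℝ f x) x :=
    ((h.cf.contDiffAt (hU.mem_nhds hx)).differentiableAt (by simp)).hasFDerivAt
  have h2 : HasFDerivAt g (fderiv ℝ g (f x)) (f x) :=
    ((h.cg.contDiffAt (hV.mem_nhds (h.mf hx))).differentiableAt (by simp)).hasFDerivAt
  have h3 := h2.comp x h1
  have h4 : HasFDerivAt (g ∘ f) (ContinuousLinearMap.id ℝ X) x := by
    refine (hasFDerivAt_id x).congr_of_eventuallyEq ?_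
    filter_upwards [hU.mem_nhds hx] with y hy
    exact h.li y hy
  have h5 := h3.unique h4
  intro v w hvw
  have := congrArg (fun L => L v - L w) h5
  simp only [ContinuousLinearMap.comp_apply, hvw, sub_self, ContinuousLinearMap.id_apply] at this
  exact (sub_eq_zero.1 this.symm)

/-- inverse function theorem, global version -/
theorem dif_of_inj [FiniteDimensional ℝ X] [FiniteDimensional ℝ Y]
    (hdim : Module.finrank ℝ X = Module.finrank ℝ Y)
    {U : Set X} (hU : IsOpen U) {f : X → Y} (hf : ContDiffOn ℝ (⊤ : ℕ∞) f U) (hinj : InjOn f U)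
    (hd : ∀ x ∈ U, Function.Injective (fderiv ℝ f x)) :
    ∃ g, Dif U (f '' U) f g ∧ IsOpen (f '' U) := by
  classical
  by_cases hne : Nonempty X
  swap
  · exact absurd ⟨0⟩ hne
  have : CompleteSpace X := FiniteDimensional.complete ℝ X
  have key : ∀ x ∈ U, ∃ e : OpenPartialHomeomorph X Y, x ∈ e.source ∧ (e : X → Y) = f ∧
      ContDiffAt ℝ (⊤ : ℕ∞) e.symm (f x) := by
    intro x hx
    let L : X ≃L[ℝ] Y := (LinearEquiv.ofInjectiveOfFinrankEq (fderiv ℝ f x).toLinearMap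
      (hd x hx) hdim).toContinuousLinearEquiv
    have hc : ContDiffAt ℝ (⊤ : ℕ∞) f x := hf.contDiffAt (hU.mem_nhds hx)
    have hL : HasFDerivAt f (L : X →L[ℝ] Y) x := by
      have h1 := (hc.differentiableAt (by simp)).hasFDerivAt
      convert h1 using 1
      ext v
      rfl
    refine ⟨hc.toOpenPartialHomeomorph f hL (by simp), ?_, rfl, ?_⟩
    · exact hc.mem_toOpenPartialHomeomorph_source hL (by simp)
    · exact hc.to_localInverse hL (by simp)
  refine ⟨Function.invFunOn f U, ⟨hf, ?_, mapsTo_image f U, ?_, ?_, ?_⟩, ?_⟩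
  · rintro _ ⟨x, hx, rfl⟩
    obtain ⟨e, hxe, rfl, hc⟩ := key x hx
    refine (hc.congr_of_eventuallyEq ?_).contDiffWithinAt
    have h1 : ∀ᶠ y in 𝓝 (e x), e.symm y ∈ U := by
      have := e.symm.continuousAt (x := e x) (e.map_source hxe)
      have h2 : U ∈ 𝓝 (e.symm (e x)) := by rw [e.left_inv hxe]; exact hU.mem_nhds hx
      exact this h2
    filter_upwards [h1, e.open_target.mem_nhds (e.map_source hxe)] with y hy hyt
    have : e (e.symm y) = y := e.right_inv hyt
    have h3 := hinj.leftInvOn_invFunOn hy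
    rw [this] at h3
    exact h3
  · rintro _ ⟨x, hx, rfl⟩
    exact Function.invFunOn_mem ⟨x, hx, rfl⟩
  · intro x hx
    exact hinj.leftInvOn_invFunOn hx
  · rintro _ ⟨x, hx, rfl⟩
    exact Function.invFunOn_eq ⟨x, hx, rfl⟩
  · rw [isOpen_iff_mem_nhds]
    rintro _ ⟨x, hx, rfl⟩
    obtain ⟨e, hxe, rfl, hc⟩ := key x hx
    have h1 : ∀ᶠ y in 𝓝 (e x), e.symm y ∈ U := by
      have := e.symm.continuousAt (x := e x) (e.map_source hxe)
      have h2 : U ∈ 𝓝 (e.symm (e x)) := by rw [e.left_inv hxe]; exact hU.mem_nhds hx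
      exact this h2
    filter_upwards [h1, e.open_target.mem_nhds (e.map_source hxe)] with y hy hyt
    exact ⟨_, hy, e.right_inv hyt⟩

end

section
variable {E : Type*} [NormedAddCommGroup E] [NormedSpace ℝ E]

/-- open half space -/
def Ho (E : Type*) : Set (E × ℝ) := {p | 0 < p.2}

theorem isOpen_Ho {E : Type*} [NormedAddCommGroup E] : IsOpen (Ho E) := isOpen_lt continuous_const continuous_snd

variable [FiniteDimensional ℝ E]

theorem dif_fib {β : E × ℝ → ℝ} (hc : ContDiffOn ℝ (⊤ : ℕ∞) β (Ho E))
    (hpos : ∀ p ∈ Ho E, 0 < β p) (hle : ∀ p ∈ Ho E, β p ≤ p.2)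
    (h1 : ∀ p : E × ℝ, 1 ≤ p.2 → β p = p.2)
    (hd : ∀ p ∈ Ho E, fderiv ℝ β p (0, 1) ≠ 0) :
    ∃ g, Dif (Ho E) (Ho E) (fun p => (p.1, β p)) g := by
  have hdβ : ∀ p ∈ Ho E, HasFDerivAt β (fderiv ℝ β p) p := fun p hp =>
    ((hc.contDiffAt (isOpen_Ho.mem_nhds hp)).differentiableAt (by simp)).hasFDerivAt
  have hline : ∀ (y : E) (t : ℝ), 0 < t →
      HasDerivAt (fun t => β (y, t)) (fderiv ℝ β (y, t) (0, 1)) t := by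
    intro y t ht
    have h2 : HasDerivAt (fun t : ℝ => (y, t)) ((0 : E), (1 : ℝ)) t :=
      (hasDerivAt_const t y).prodMk (hasDerivAt_id t)
    exact (hdβ (y, t) ht).comp_hasDerivAt t h2
  have hinj1 : ∀ (y : E) (s t : ℝ), 0 < s → s < t → β (y, s) ≠ β (y, t) := by
    intro y s t hs hst he
    obtain ⟨c, hc, hc'⟩ := exists_hasDerivAt_eq_zero (f := fun t => β (y, t))
      (f' := fun t => fderiv ℝ β (y, t) (0, 1)) hst
      (fun r hr => (hline y r (hs.trans_le hr.1)).continuousAt.continuousWithinAt) he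
      (fun r hr => hline y r (hs.trans hr.1))
    exact hd (y, c) (hs.trans hc.1) hc'
  have hinj : InjOn (fun p : E × ℝ => (p.1, β p)) (Ho E) := by
    rintro ⟨y, s⟩ hs ⟨z, t⟩ ht h
    simp only [Prod.mk.injEq] at h
    obtain ⟨rfl, h⟩ := h
    rcases lt_trichotomy s t with h2 | h2 | h2
    · exact absurd h (hinj1 y s t hs h2)
    · rw [h2]
    · exact absurd h.symm (hinj1 y t s ht h2)
  have himg : (fun p : E × ℝ => (p.1, β p)) '' (Ho E) = Ho E := by
    apply Subset.antisymm
    · rintro _ ⟨p, hp, rfl⟩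
      exact hpos p hp
    · rintro ⟨y, s⟩ hs
      have hs : 0 < s := hs
      have := intermediate_value_Icc (le_max_left s 1) (f := fun t => β (y, t))
        (fun r hr => (hline y r (hs.trans_le hr.1)).continuousAt.continuousWithinAt)
      have hmem : s ∈ Icc (β (y, s)) (β (y, max s 1)) := by
        refine ⟨hle (y, s) hs, ?_⟩
        rw [h1 _ (le_max_right s 1)]
        exact le_max_left s 1
      obtain ⟨t, ht, hts⟩ := this hmem
      exact ⟨(y, t), hs.trans_le ht.1, by simpa using hts⟩
  have := dif_of_inj (f := fun p : E × ℝ => (p.1, β p)) rfl isOpen_Ho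
    (contDiff_fst.contDiffOn.prodMk hc) hinj ?_
  · obtain ⟨g, hg, -⟩ := this
    rw [himg] at hg
    exact ⟨g, hg⟩
  · intro p hp
    have h3 : HasFDerivAt (fun p : E × ℝ => (p.1, β p)) _ p :=
      (hasFDerivAt_fst).prodMk (hdβ p hp)
    rw [h3.fderiv, injective_iff_map_eq_zero]
    rintro ⟨v, r⟩ h
    simp only [ContinuousLinearMap.prod_apply, ContinuousLinearMap.coe_fst', Prod.mk_eq_zero] at h
    obtain ⟨rfl, h⟩ := h
    have h4 : ((0 : E), r) = r • ((0 : E), (1 : ℝ)) := by simp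
    rw [h4, map_smul, smul_eq_zero] at h
    rcases h with h | h
    · simp [h]
    · exact absurd h (hd p hp)

theorem dif_shift {w : E × ℝ → E} (hc : ContDiffOn ℝ (⊤ : ℕ∞) w (Ho E))
    (hw : ∀ p ∈ Ho E, ∀ v, ‖fderiv ℝ w p (v, 0)‖ ≤ 1 / 2 * ‖v‖) :
    ∃ g, Dif (Ho E) (Ho E) (fun p => (p.1 + w p, p.2)) g := by
  have : CompleteSpace E := FiniteDimensional.complete ℝ E
  have hdw : ∀ p ∈ Ho E, HasFDerivAt w (fderiv ℝ w p) p := fun p hp =>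
    ((hc.contDiffAt (isOpen_Ho.mem_nhds hp)).differentiableAt (by simp)).hasFDerivAt
  have hlip : ∀ t : ℝ, 0 < t → LipschitzWith (1 / 2) (fun x => w (x, t)) := by
    intro t ht
    have h1 : ∀ x, HasFDerivAt (fun x => w (x, t))
        ((fderiv ℝ w (x, t)).comp (ContinuousLinearMap.inl ℝ E ℝ)) x := by
      intro x
      have h2 : HasFDerivAt (fun x : E => (x, t)) (ContinuousLinearMap.inl ℝ E ℝ) x :=
        hasFDerivAt_prodMk_left x t
      exact (hdw (x, t) ht).comp x h2
    refine lipschitzWith_of_nnnorm_fderiv_le (𝕜 := ℝ) (fun x => (h1 x).differentiableAt) ?_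
    intro x
    rw [(h1 x).fderiv, ← NNReal.coe_le_coe]
    refine ContinuousLinearMap.opNorm_le_bound _ (by positivity) ?_
    intro v
    simpa using hw (x, t) ht v
  have hinj : InjOn (fun p : E × ℝ => (p.1 + w p, p.2)) (Ho E) := by
    rintro ⟨y, s⟩ hs ⟨z, t⟩ ht h
    simp only [Prod.mk.injEq] at h
    obtain ⟨h, rfl⟩ := h
    have h2 := (hlip s hs).dist_le_mul y z
    rw [dist_eq_norm, dist_eq_norm] at h2
    have h3 : y - z = -(w (y, s) - w (z, s)) := by
      rw [neg_sub, sub_eq_sub_iff_add_eq_add, h, add_comm]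
    have h4 : ‖y - z‖ = ‖w (y, s) - w (z, s)‖ := by rw [h3, norm_neg]
    have h5 : ‖y - z‖ = 0 := by
      have := norm_nonneg (y - z)
      rw [← h4] at h2
      norm_num at h2
      linarith
    rw [norm_eq_zero, sub_eq_zero] at h5
    rw [h5]
  have himg : (fun p : E × ℝ => (p.1 + w p, p.2)) '' (Ho E) = Ho E := by
    apply Subset.antisymm
    · rintro _ ⟨p, hp, rfl⟩
      exact hp
    · rintro ⟨y, s⟩ hs
      have hk : ContractingWith (1 / 2) (fun x => y - w (x, s)) := by
        refine ⟨by norm_num, ?_⟩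
        refine LipschitzWith.of_dist_le_mul fun a b => ?_
        have := (hlip s hs).dist_le_mul a b
        rw [dist_eq_norm] at this ⊢
        rw [sub_sub_sub_cancel_left, norm_sub_rev]
        exact this
      refine ⟨(hk.fixedPoint, s), hs, ?_⟩
      have := hk.fixedPoint_isFixedPt
      simp only [Function.IsFixedPt] at this
      simp only [Prod.mk.injEq, and_true]
      nth_rewrite 1 [← this]
      simp
  have := dif_of_inj (f := fun p : E × ℝ => (p.1 + w p, p.2)) rfl isOpen_Ho
    ((contDiff_fst.contDiffOn.add hc).prodMk contDiff_snd.contDiffOn) hinj ?_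
  · obtain ⟨g, hg, -⟩ := this
    rw [himg] at hg
    exact ⟨g, hg⟩
  · intro p hp
    have h3 : HasFDerivAt (fun p : E × ℝ => (p.1 + w p, p.2)) _ p :=
      (hasFDerivAt_fst.add (hdw p hp)).prodMk hasFDerivAt_snd
    rw [h3.fderiv, injective_iff_map_eq_zero]
    rintro ⟨v, r⟩ h
    simp only [ContinuousLinearMap.prod_apply, ContinuousLinearMap.coe_fst', Prod.mk_eq_zero,
      add_apply, ContinuousLinearMap.coe_snd'] at h
    obtain ⟨h, rfl⟩ := h
    have h4 := hw p hp v
    have h5 : ‖v‖ = ‖fderiv ℝ w p (v, 0)‖ := by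
      rw [← norm_neg (fderiv ℝ w p (v, 0)), ← eq_neg_of_add_eq_zero_left h]
    have h6 : ‖v‖ = 0 := by
      have := norm_nonneg v
      linarith
    rw [norm_eq_zero] at h6
    simp [h6]

theorem dif_G {w : E × ℝ → E} {σ : E × ℝ → ℝ} (hc : ContDiffOn ℝ (⊤ : ℕ∞) w (Ho E))
    (hσ : ContDiffOn ℝ (⊤ : ℕ∞) σ (Ho E))
    (hw : ∀ p ∈ Ho E, ∀ v, ‖fderiv ℝ w p (v, 0)‖ ≤ 1 / 2 * ‖v‖)
    (hpos : ∀ p ∈ Ho E, 0 < σ p) (hle : ∀ p ∈ Ho E, σ p ≤ p.2)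
    (h1 : ∀ p : E × ℝ, 1 ≤ p.2 → σ p = p.2)
    (hd : ∀ p ∈ Ho E, Function.Injective (fderiv ℝ (fun p => (p.1 + w p, σ p)) p)) :
    ∃ g, Dif (Ho E) (Ho E) (fun p => (p.1 + w p, σ p)) g := by
  obtain ⟨a, ha⟩ := dif_shift hc hw
  have ha2 : ∀ p ∈ Ho E, (a p).2 = p.2 := fun p hp => by
    have := congrArg Prod.snd (ha.ri p hp)
    exact this
  have ha1 : ∀ p ∈ Ho E, (a p).1 + w (a p) = p.1 := fun p hp => by
    have := congrArg Prod.fst (ha.ri p hp)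
    exact this
  have hG : ContDiffOn ℝ (⊤ : ℕ∞) (fun p : E × ℝ => (p.1 + w p, σ p)) (Ho E) :=
    (contDiff_fst.contDiffOn.add hc).prodMk hσ
  have hB : ContDiffOn ℝ (⊤ : ℕ∞) (σ ∘ a) (Ho E) := hσ.comp ha.cg ha.mg
  obtain ⟨b, hb⟩ := dif_fib (β := σ ∘ a) hB
    (fun p hp => hpos _ (ha.mg hp))
    (fun p hp => (hle _ (ha.mg hp)).trans_eq (ha2 p hp))
    (fun p hp => by
      have hp' : p ∈ Ho E := lt_of_lt_of_le one_pos hp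
      have : σ (a p) = (a p).2 := h1 _ (by rw [ha2 p hp']; exact hp)
      simp [this, ha2 p hp'])
    (fun p hp h0 => by
      have d1 : HasFDerivAt (fun p : E × ℝ => (p.1 + w p, σ p)) _ (a p) :=
        ((hG.contDiffAt (isOpen_Ho.mem_nhds (ha.mg hp))).differentiableAt (by simp)).hasFDerivAt
      have d2 : HasFDerivAt a _ p :=
        ((ha.cg.contDiffAt (isOpen_Ho.mem_nhds hp)).differentiableAt (by simp)).hasFDerivAt
      have d3 := d1.comp p d2
      have d4 : HasFDerivAt (σ ∘ a) _ p :=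
        ((hB.contDiffAt (isOpen_Ho.mem_nhds hp)).differentiableAt (by simp)).hasFDerivAt
      have d5 : HasFDerivAt ((fun p : E × ℝ => (p.1 + w p, σ p)) ∘ a)
          ((ContinuousLinearMap.fst ℝ E ℝ).prod (fderiv ℝ (σ ∘ a) p)) p := by
        refine (hasFDerivAt_fst.prodMk d4).congr_of_eventuallyEq ?_
        filter_upwards [isOpen_Ho.mem_nhds hp] with q hq
        simp [ha1 q hq]
      have d6 := d3.unique d5
      have d7 := DFunLike.congr_fun d6 ((0 : E), (1 : ℝ))
      simp only [ContinuousLinearMap.comp_apply, ContinuousLinearMap.prod_apply, h0,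
        ContinuousLinearMap.coe_fst'] at d7
      have d8 := hd _ (ha.mg hp) (d7.trans (map_zero _).symm)
      have d9 := ha.symm.fderiv_inj isOpen_Ho isOpen_Ho hp (d8.trans (map_zero _).symm)
      simp at d9)
  refine ⟨a ∘ b, (hb.comp ha).congr ?_⟩
  intro p hp
  have := ha.li p hp
  simp only [Function.comp] at this ⊢
  rw [this]

end
end CollarAux

namespace CollarAux

open Set Filter Topology

open scoped Manifold in
theorem exists_smooth_le {m : ℝ → ℝ} (hm : Antitone m) (hpos : ∀ r, 0 < m r) :
    ∃ f : ℝ → ℝ, ContDiff ℝ (⊤ : ℕ∞) f ∧ ∀ r, 0 < f r ∧ f r ≤ m r := by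
  obtain ⟨f, hf⟩ := exists_contMDiffMap_forall_mem_convex_of_local_const (n := ((⊤ : ℕ∞)))
    (I := 𝓘(ℝ, ℝ)) (M := ℝ) (F := ℝ)
    (t := fun r => Ioc 0 (m r)) (fun r => convex_Ioc 0 (m r)) (by
      intro r
      refine ⟨m (r + 1), ?_⟩
      filter_upwards [Iio_mem_nhds (lt_add_one r)] with y hy
      exact ⟨hpos _, hm (le_of_lt hy)⟩)
  exact ⟨f, f.contMDiff.contDiff, fun r => hf r⟩

theorem exists_omega {e : ℝ → ℝ} (he : Antitone e) (hpos : ∀ r, 0 < e r) :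
    ∃ w w' : ℝ → ℝ, ContDiff ℝ (⊤ : ℕ∞) w ∧ (∀ r, HasDerivAt w (w' r) r) ∧
      ∀ r, 0 ≤ r → 0 < w r ∧ w r ≤ e r ∧ |w' r| ≤ e r * Real.exp (-r) := by
  obtain ⟨f, hf, hfm⟩ := exists_smooth_le (m := fun r => e r * Real.exp (-r))
    (fun a b hab => mul_le_mul (he hab) (Real.exp_le_exp.2 (neg_le_neg hab))
      (Real.exp_pos _).le (hpos _).le) (fun r => mul_pos (hpos r) (Real.exp_pos _))
  have hIntg : ∀ r, MeasureTheory.IntegrableOn f (Ioi r) := by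
    intro r
    have h1 : MeasureTheory.IntegrableOn (fun x => e r * Real.exp (-x)) (Ioi r) :=
      (integrableOn_exp_neg_Ioi r).const_mul _
    refine h1.mono' hf.continuous.aestronglyMeasurable ?_
    refine (MeasureTheory.ae_restrict_iff' measurableSet_Ioi).2 (Eventually.of_forall ?_)
    intro x hx
    rw [Real.norm_of_nonneg (hfm x).1.le]
    refine (hfm x).2.trans (mul_le_mul_of_nonneg_right (he (le_of_lt hx)) (Real.exp_pos _).le)
  have hII : ∀ a b, IntervalIntegrable f MeasureTheory.volume a b :=
    fun a b => hf.continuous.intervalIntegrable a b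
  have hsplit : ∀ r, 0 ≤ r → (∫ x in Ioi 0, f x) - ∫ x in (0:ℝ)..r, f x = ∫ x in Ioi r, f x := by
    intro r hr
    rw [← intervalIntegral.integral_Ioi_sub_Ioi (hIntg 0) hr]
    ring
  have hder : ∀ r, HasDerivAt (fun r => (∫ x in Ioi 0, f x) - ∫ x in (0:ℝ)..r, f x) (-f r) r := by
    intro r
    have := (intervalIntegral.integral_hasDerivAt_right (hII 0 r)
      (hf.continuous.stronglyMeasurableAtFilter _ _) hf.continuous.continuousAt).const_sub
      (∫ x in Ioi 0, f x)
    exact this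
  refine ⟨fun r => (∫ x in Ioi 0, f x) - ∫ x in (0:ℝ)..r, f x, fun r => - f r, ?_, hder, ?_⟩
  · have h2 : deriv (fun r => (∫ x in Ioi 0, f x) - ∫ x in (0:ℝ)..r, f x) = fun r => - f r :=
      funext fun r => (hder r).deriv
    rw [contDiff_infty_iff_deriv, h2]
    exact ⟨fun r => (hder r).differentiableAt, hf.neg⟩
  · intro r hr
    simp only [hsplit r hr]
    refine ⟨?_, ?_, ?_⟩
    · rw [MeasureTheory.setIntegral_pos_iff_support_of_nonneg_ae
        (Eventually.of_forall fun x => (hfm x).1.le) (hIntg r)]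
      have : Function.support f = univ := by
        ext x; simp [(hfm x).1.ne']
      rw [this, univ_inter, Real.volume_Ioi]
      simp
    · calc ∫ x in Ioi r, f x ≤ ∫ x in Ioi r, e r * Real.exp (-x) := by
            refine MeasureTheory.setIntegral_mono_on (hIntg r)
              ((integrableOn_exp_neg_Ioi r).const_mul _) measurableSet_Ioi ?_
            intro x hx
            exact (hfm x).2.trans
              (mul_le_mul_of_nonneg_right (he (le_of_lt hx)) (Real.exp_pos _).le)
        _ = e r * Real.exp (-r) := by
            rw [MeasureTheory.integral_const_mul, integral_exp_neg_Ioi]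
        _ ≤ e r * 1 := by
            refine mul_le_mul_of_nonneg_left ?_ (hpos r).le
            rw [Real.exp_le_one_iff]; linarith
        _ = e r := mul_one _
    · rw [abs_neg, abs_of_pos (hfm r).1]
      exact (hfm r).2

theorem exists_delta {E : Type*} [NormedAddCommGroup E] [InnerProductSpace ℝ E]
    [FiniteDimensional ℝ E] {P : E → ℝ → Prop}
    (hmono : ∀ x a b, 0 < a → a ≤ b → P x b → P x a)
    (hloc : ∀ x, ∃ a, 0 < a ∧ ∀ᶠ y in 𝓝 x, P y a) :
    ∃ δ : E → ℝ, ContDiff ℝ (⊤ : ℕ∞) δ ∧ ∀ x, 0 < δ x ∧ ∃ η, P x η ∧ 0 < η ∧ δ x ≤ η ∧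
      ‖fderiv ℝ δ x‖ ≤ η := by
  have hball : ∀ n : ℕ, ∃ a, 0 < a ∧ ∀ x ∈ Metric.closedBall (0 : E) n, P x a := by
    intro n
    refine (isCompact_closedBall (0 : E) n).induction_on
      (p := fun s => ∃ a, 0 < a ∧ ∀ x ∈ s, P x a) ⟨1, one_pos, by simp⟩ ?_ ?_ ?_
    · rintro s t hst ⟨a, ha, h⟩
      exact ⟨a, ha, fun x hx => h x (hst hx)⟩
    · rintro s t ⟨a, ha, h⟩ ⟨b, hb, h'⟩
      refine ⟨min a b, lt_min ha hb, ?_⟩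
      rintro x (hx | hx)
      · exact hmono x _ _ (lt_min ha hb) (min_le_left _ _) (h x hx)
      · exact hmono x _ _ (lt_min ha hb) (min_le_right _ _) (h' x hx)
    · intro x hx
      obtain ⟨a, ha, h⟩ := hloc x
      exact ⟨_, mem_nhdsWithin_of_mem_nhds h, a, ha, fun y hy => hy⟩
  choose a ha hPa using hball
  let b : ℕ → ℝ := fun n => Nat.rec (a 0) (fun n r => min r (a (n + 1))) n
  have hbs : ∀ n, b (n + 1) = min (b n) (a (n + 1)) := fun n => rfl
  have hbpos : ∀ n, 0 < b n := by
    intro n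
    induction n with
    | zero => exact ha 0
    | succ n ih => rw [hbs]; exact lt_min ih (ha _)
  have hba : ∀ n, b n ≤ a n := by
    intro n
    cases n with
    | zero => exact le_refl _
    | succ n => rw [hbs]; exact min_le_right _ _
  have hbanti : Antitone b := antitone_nat_of_succ_le fun n => by rw [hbs]; exact min_le_left _ _
  obtain ⟨w, w', hw, hw', hwb⟩ := exists_omega (e := fun r => b ⌈Real.sqrt r⌉₊)
    (fun r s hrs => hbanti (Nat.ceil_mono (Real.sqrt_le_sqrt hrs))) (fun r => hbpos _)
  refine ⟨fun x => w (‖x‖ ^ 2), hw.comp (contDiff_norm_sq ℝ), ?_⟩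
  intro x
  obtain ⟨h1, h2, h3⟩ := hwb (‖x‖ ^ 2) (by positivity)
  simp only [Real.sqrt_sq (norm_nonneg x)] at h2 h3
  refine ⟨h1, b ⌈‖x‖⌉₊, ?_, hbpos _, h2, ?_⟩
  · refine hmono x _ _ (hbpos _) (hba _) (hPa _ x ?_)
    simpa using Nat.le_ceil ‖x‖
  · have hd : HasFDerivAt (fun x : E => w (‖x‖ ^ 2)) _ x :=
      (hw' (‖x‖ ^ 2)).comp_hasFDerivAt x (hasStrictFDerivAt_norm_sq x).hasFDerivAt
    rw [hd.fderiv, norm_smul, Real.norm_eq_abs]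
    have h4 : ‖(2 : ℕ) • innerSL ℝ x‖ ≤ 2 * ‖x‖ := by
      refine (norm_nsmul_le).trans ?_
      simp
    have h5 : 2 * ‖x‖ ≤ Real.exp (‖x‖ ^ 2) := by
      have := Real.add_one_le_exp (‖x‖ ^ 2)
      nlinarith [sq_nonneg (‖x‖ - 1)]
    calc |w' (‖x‖ ^ 2)| * _ ≤ (b ⌈‖x‖⌉₊ * Real.exp (-‖x‖ ^ 2)) * Real.exp (‖x‖ ^ 2) := by
          refine mul_le_mul ?_ (h4.trans h5) (norm_nonneg _)
            (mul_nonneg (hbpos _).le (Real.exp_pos _).le)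
          simpa using h3
      _ = b ⌈‖x‖⌉₊ := by
          rw [mul_assoc, ← Real.exp_add]; simp

end CollarAux

namespace CollarAux

open Set Filter Topology

theorem exists_chi : ∃ (χ χ' : ℝ → ℝ) (K : ℝ), ContDiff ℝ (⊤ : ℕ∞) χ ∧
    (∀ t, HasDerivAt χ (χ' t) t) ∧ (∀ t, 0 ≤ χ t) ∧ (∀ t, χ t ≤ 1) ∧ (∀ t, t ≤ 1 / 3 → χ t = 1) ∧
    (∀ t, 2 / 3 ≤ t → χ t = 0) ∧ (∀ t, χ' t ≤ 0) ∧ 1 ≤ K ∧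
    (∀ t, 0 ≤ t → t ≤ 1 → |χ' t| ≤ K - 1) := by
  have hc : ContDiff ℝ (⊤ : ℕ∞) (fun t : ℝ => Real.smoothTransition (2 - 3 * t)) :=
    Real.smoothTransition.contDiff.comp (contDiff_const.sub (contDiff_const.mul contDiff_id))
  have hanti : Antitone (fun t : ℝ => Real.smoothTransition (2 - 3 * t)) := fun a b hab =>
    Real.smoothTransition.monotone (by linarith)
  have hcd : Continuous (deriv (fun t : ℝ => Real.smoothTransition (2 - 3 * t))) :=
    hc.continuous_deriv (by simp)
  obtain ⟨B, hB⟩ := (isCompact_Icc (a := (0 : ℝ)) (b := 1)).exists_bound_of_continuousOn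
    hcd.continuousOn
  refine ⟨fun t => Real.smoothTransition (2 - 3 * t),
    deriv (fun t : ℝ => Real.smoothTransition (2 - 3 * t)), max B 0 + 1, hc, ?_, ?_, ?_, ?_, ?_,
    ?_, ?_, ?_⟩
  · intro t
    exact (hc.differentiable (by simp) t).hasDerivAt
  · intro t; exact Real.smoothTransition.nonneg _
  · intro t; exact Real.smoothTransition.le_one _
  · intro t ht; exact Real.smoothTransition.one_of_one_le (by linarith)
  · intro t ht; exact Real.smoothTransition.zero_of_nonpos (by linarith)
  · intro t; exact hanti.deriv_nonpos
  · have := le_max_right B 0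
    linarith
  · intro t h0 h1
    have := hB t ⟨h0, h1⟩
    rw [Real.norm_eq_abs] at this
    have := le_max_left B 0
    linarith

section
variable {E : Type*} [NormedAddCommGroup E] [InnerProductSpace ℝ E]

/-- closed strip -/
def H1 (E : Type*) : Set (E × ℝ) := {p | 0 ≤ p.2 ∧ p.2 ≤ 1}

/-- quantitative smallness of `η` at `x` -/
def Good (K : ℝ) (L : E × ℝ → (E × ℝ →L[ℝ] E × ℝ)) (x : E) (η : ℝ) : Prop :=
  ∃ C c : ℝ, 1 ≤ C ∧ 0 < c ∧ 8 * K * C * η ≤ 1 ∧ ∀ s, 0 ≤ s → s ≤ η →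
    (∀ v, ‖(L (x, s) (v, 0)).1 - v‖ ≤ 1 / 4 * ‖v‖) ∧ ‖(L (x, s) (0, 1)).1‖ ≤ C ∧
    (∀ v, 8 * K * C * |(L (x, s) (v, 0)).2| ≤ c * ‖v‖) ∧
    c ≤ (L (x, s) (0, 1)).2 ∧ (L (x, s) (0, 1)).2 ≤ C

theorem good_loc {K : ℝ} (hK : 1 ≤ K) {L : E × ℝ → (E × ℝ →L[ℝ] E × ℝ)}
    (hL : ContinuousOn L (H1 E)) (hL0 : ∀ x v, L (x, 0) (v, 0) = (v, 0))
    (hLp : ∀ x, 0 < (L (x, 0) (0, 1)).2) (x : E) :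
    ∃ a, 0 < a ∧ ∀ᶠ y in 𝓝 x, Good K L y a := by
  set b := (L (x, 0) (0, 1)).1 with hb
  set d := (L (x, 0) (0, 1)).2 with hd
  have hd0 : 0 < d := hLp x
  set C := 2 + ‖b‖ + d with hC
  have hC1 : 1 ≤ C := by have := norm_nonneg b; linarith
  have hKC : 1 ≤ K * C := by nlinarith
  set ε := min (1 / 4) (min (d / 2) (d / 2 / (8 * K * C))) with hε
  have hε0 : 0 < ε := by
    refine lt_min (by norm_num) (lt_min (by linarith) (by positivity))
  have hε1 : ε ≤ 1 / 4 := min_le_left _ _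
  have hε2 : ε ≤ d / 2 := (min_le_right _ _).trans (min_le_left _ _)
  have hε3 : 8 * K * C * ε ≤ d / 2 := by
    have : ε ≤ d / 2 / (8 * K * C) := (min_le_right _ _).trans (min_le_right _ _)
    rw [le_div_iff₀ (by linarith)] at this
    linarith
  have h1 : ∀ᶠ p in 𝓝[H1 E] (x, (0 : ℝ)), ‖L p - L (x, 0)‖ < ε := by
    have h2 : Tendsto L (𝓝[H1 E] (x, (0 : ℝ))) (𝓝 (L (x, 0))) :=
      hL (x, 0) ⟨le_refl _, zero_le_one⟩
    have := (Metric.tendsto_nhds (α := E × ℝ →L[ℝ] E × ℝ) (u := L)).1 h2 ε hε0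
    filter_upwards [this] with p hp
    exact (dist_eq_norm (L p) (L (x, 0))).symm.trans_lt hp
  rw [eventually_nhdsWithin_iff, nhds_prod_eq, eventually_prod_iff] at h1
  obtain ⟨pa, hpa, pb, hpb, hab⟩ := h1
  obtain ⟨r, hr, hrb⟩ := Metric.eventually_nhds_iff.1 hpb
  refine ⟨min (r / 2) (1 / (8 * K * C)), lt_min (by linarith) (by
    apply one_div_pos.2; linarith), ?_⟩
  filter_upwards [hpa] with y hy
  refine ⟨C, d / 2, hC1, by linarith, ?_, ?_⟩
  · have : min (r / 2) (1 / (8 * K * C)) ≤ 1 / (8 * K * C) := min_le_right _ _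
    rw [le_div_iff₀ (by linarith)] at this
    linarith
  · intro s hs0 hs
    have hs1 : s < r := by
      have := min_le_left (r / 2) (1 / (8 * K * C))
      linarith
    have hs2 : s ≤ 1 := by
      have := min_le_right (r / 2) (1 / (8 * K * C))
      have h3 : 1 / (8 * K * C) ≤ 1 := by
        rw [div_le_one (by linarith)]; linarith
      linarith
    have hn : ‖L (y, s) - L (x, 0)‖ < ε :=
      hab hy (hrb (by rw [Real.dist_eq, sub_zero, abs_of_nonneg hs0]; exact hs1)) ⟨hs0, hs2⟩
    have hv : ∀ v, ‖L (y, s) (v, 0) - (v, 0)‖ ≤ ε * ‖v‖ := by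
      intro v
      have := (L (y, s) - L (x, 0)).le_opNorm (v, 0)
      rw [sub_apply, hL0] at this
      refine this.trans ?_
      simp only [Prod.norm_mk, norm_zero, norm_nonneg, sup_of_le_left]
      exact mul_le_mul_of_nonneg_right hn.le (norm_nonneg v)
    have ht : ‖L (y, s) (0, 1) - L (x, 0) (0, 1)‖ ≤ ε := by
      have := (L (y, s) - L (x, 0)).le_opNorm (0, 1)
      rw [sub_apply] at this
      refine this.trans ?_
      simp only [Prod.norm_mk, norm_zero, norm_one, zero_le_one, sup_of_le_right, mul_one]
      exact hn.le
    have ht1 := (norm_fst_le _).trans ht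
    have ht2 := (norm_snd_le _).trans ht
    simp only [Prod.fst_sub, Prod.snd_sub] at ht1 ht2
    rw [Real.norm_eq_abs, abs_le] at ht2
    refine ⟨?_, ?_, ?_, ?_, ?_⟩
    · intro v
      have := (norm_fst_le _).trans (hv v)
      simp only [Prod.fst_sub] at this
      exact this.trans (mul_le_mul_of_nonneg_right hε1 (norm_nonneg v))
    · have := norm_le_insert' (L (y, s) (0, 1)).1 b
      linarith
    · intro v
      have := (norm_snd_le _).trans (hv v)
      simp only [Prod.snd_sub, sub_zero, Real.norm_eq_abs] at this
      calc 8 * K * C * |(L (y, s) (v, 0)).2| ≤ 8 * K * C * (ε * ‖v‖) :=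
            mul_le_mul_of_nonneg_left this (by linarith)
        _ = 8 * K * C * ε * ‖v‖ := by ring
        _ ≤ _ := mul_le_mul_of_nonneg_right hε3 (norm_nonneg v)
    · linarith [ht2.1]
    · have := norm_nonneg b
      linarith [ht2.2]

theorem good_mono {K : ℝ} (hK : 1 ≤ K) {L : E × ℝ → (E × ℝ →L[ℝ] E × ℝ)} (x : E) (a b : ℝ)
    (_ : 0 < a) (hab : a ≤ b) (h : Good K L x b) : Good K L x a := by
  obtain ⟨C, c, hC, hc, h1, h2⟩ := h
  refine ⟨C, c, hC, hc, ?_, fun s h0 h3 => h2 s h0 (h3.trans hab)⟩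
  refine le_trans (mul_le_mul_of_nonneg_left hab ?_) h1
  nlinarith

/-- the linear-algebra heart: injectivity of the interpolated derivative -/
theorem inj_alg {K C c η δ t X X' : ℝ} {l l1 : E × ℝ} {dv : ℝ} {v u : E} {r τ : ℝ}
    (hK : 1 ≤ K) (hC : 1 ≤ C) (hc : 0 < c) (hη : 8 * K * C * η ≤ 1) (hδ : 0 < δ)
    (hδη : δ ≤ η) (ht0 : 0 < t) (ht1 : t ≤ 1) (hX0 : 0 ≤ X) (hX1 : X ≤ 1)
    (hX' : X' ≤ 0) (hX'K : |X'| ≤ K - 1)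
    (hl1 : ‖l.1 - v‖ ≤ 1 / 4 * ‖v‖) (hl2 : 8 * K * C * |l.2| ≤ c * ‖v‖)
    (h1 : ‖l1.1‖ ≤ C) (h2 : c ≤ l1.2) (hdv : |dv| ≤ η * ‖v‖)
    (hu : ‖u‖ ≤ C * δ) (hτt : τ ≤ t)
    (e1 : v + (X • ((l + (δ * r + t * dv) • l1).1 - v) + (X' * r) • u) = 0)
    (e2 : X * (l + (δ * r + t * dv) • l1).2 + X' * r * τ + (1 - X) * r - X' * r * t = 0) :
    v = 0 ∧ r = 0 := by
  have hKC : 1 ≤ K * C := by nlinarith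
  have hη0 : 0 < η := hδ.trans_le hδη
  have hCη : C * η ≤ 1 / 8 := by nlinarith [mul_pos (by linarith : 0 < C) hη0]
  have hv0 := norm_nonneg v
  have hr0 := abs_nonneg r
  have htdv : |t * dv| ≤ η * ‖v‖ := by
    rw [abs_mul, abs_of_pos ht0]
    nlinarith [abs_nonneg dv]
  -- bound on `v`
  have hv1 : ‖v‖ ≤ 1 / 4 * ‖v‖ + (δ * |r| + η * ‖v‖) * C + (K - 1) * |r| * (C * δ) := by
    have e3 : v = -(X • ((l.1 - v) + (δ * r + t * dv) • l1.1) + (X' * r) • u) := by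
      rw [eq_neg_iff_add_eq_zero, ← e1]
      congr 3
      simp only [Prod.fst_add, Prod.smul_fst]
      abel
    have e4 : ‖v‖ ≤ ‖X • ((l.1 - v) + (δ * r + t * dv) • l1.1)‖ + ‖(X' * r) • u‖ := by
      calc ‖v‖ = ‖-(X • ((l.1 - v) + (δ * r + t * dv) • l1.1) + (X' * r) • u)‖ := by rw [← e3]
        _ ≤ _ := by rw [norm_neg]; exact norm_add_le _ _
    have e5 : ‖X • ((l.1 - v) + (δ * r + t * dv) • l1.1)‖ ≤
        1 / 4 * ‖v‖ + (δ * |r| + η * ‖v‖) * C := by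
      rw [norm_smul, Real.norm_of_nonneg hX0]
      have e6 : ‖(l.1 - v) + (δ * r + t * dv) • l1.1‖ ≤
          1 / 4 * ‖v‖ + (δ * |r| + η * ‖v‖) * C := by
        refine (norm_add_le _ _).trans (add_le_add hl1 ?_)
        rw [norm_smul, Real.norm_eq_abs]
        refine mul_le_mul ?_ h1 (norm_nonneg _) (by positivity)
        refine (abs_add_le _ _).trans (add_le_add ?_ htdv)
        rw [abs_mul, abs_of_pos hδ]
      exact (mul_le_of_le_one_left (norm_nonneg _) hX1).trans e6
    have e7 : ‖(X' * r) • u‖ ≤ (K - 1) * |r| * (C * δ) := by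
      rw [norm_smul, Real.norm_eq_abs, abs_mul]
      refine mul_le_mul (mul_le_mul_of_nonneg_right hX'K hr0) hu (norm_nonneg _) ?_
      exact mul_nonneg (by linarith) hr0
    linarith
  have hv2 : ‖v‖ ≤ 2 * (K * C) * δ * |r| := by
    have : η * ‖v‖ * C ≤ 1 / 8 * ‖v‖ := by nlinarith
    have h9 : 0 ≤ K * C * δ * |r| := by positivity
    nlinarith
  have hd0 : 0 < l1.2 := hc.trans_le h2
  -- bound on `r`
  have hr1 : |r| * (X * δ * l1.2 + (1 - X)) ≤ X * (l1.2 * δ * |r| / 2) := by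
    have e3 : r * (X * δ * l1.2 + (1 - X) + (-X') * (t - τ)) = -(X * (l.2 + t * dv * l1.2)) := by
      simp only [Prod.snd_add, Prod.smul_snd, smul_eq_mul] at e2
      linarith
    have hA : 0 ≤ (-X') * (t - τ) := mul_nonneg (by linarith) (by linarith)
    have hB : 0 ≤ X * δ * l1.2 + (1 - X) := by
      have : 0 ≤ X * δ * l1.2 := by positivity
      linarith
    have e4 : |r| * (X * δ * l1.2 + (1 - X)) ≤ |X * (l.2 + t * dv * l1.2)| := by
      rw [← abs_neg (X * _), ← e3, abs_mul, abs_of_nonneg (by linarith : 0 ≤ X * δ * l1.2 + (1 - X) + (-X') * (t - τ))]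
      exact mul_le_mul_of_nonneg_left (by linarith) hr0
    refine e4.trans ?_
    rw [abs_mul, abs_of_nonneg hX0]
    refine mul_le_mul_of_nonneg_left ?_ hX0
    have e5 : |l.2 + t * dv * l1.2| ≤ |l.2| + η * ‖v‖ * l1.2 := by
      refine (abs_add_le _ _).trans (add_le_add le_rfl ?_)
      rw [abs_mul, abs_of_pos hd0]
      exact mul_le_mul_of_nonneg_right htdv hd0.le
    refine e5.trans ?_
    have e6 : 8 * (K * C) * (|l.2| + η * ‖v‖ * l1.2) ≤ 8 * (K * C) * (l1.2 * δ * |r| / 2) := by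
      have a1 : c * ‖v‖ ≤ l1.2 * ‖v‖ := mul_le_mul_of_nonneg_right h2 hv0
      have a2 : 8 * K * C * η * (‖v‖ * l1.2) ≤ 1 * (‖v‖ * l1.2) :=
        mul_le_mul_of_nonneg_right hη (by positivity)
      have a3 : l1.2 * ‖v‖ ≤ l1.2 * (2 * (K * C) * δ * |r|) :=
        mul_le_mul_of_nonneg_left hv2 hd0.le
      linarith
    exact le_of_mul_le_mul_left e6 (by linarith)
  have hr2 : r = 0 := by
    by_contra hne
    have hrp : 0 < |r| := abs_pos.2 hne
    have : 0 < X * δ * l1.2 / 2 + (1 - X) := by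
      rcases hX0.eq_or_lt with h | h
      · rw [← h]; norm_num
      · have : 0 < X * δ * l1.2 := by positivity
        linarith
    nlinarith
  refine ⟨?_, hr2⟩
  rw [hr2, abs_zero, mul_zero] at hv2
  exact norm_le_zero_iff.1 hv2

end

end CollarAux

namespace CollarAux

open Set Filter Topology

section
variable {E : Type*} [NormedAddCommGroup E] [InnerProductSpace ℝ E]

theorem uniqueDiffOn_H1 {E : Type*} [NormedAddCommGroup E] [NormedSpace ℝ E] :
    UniqueDiffOn ℝ (H1 E) := by
  have : H1 E = univ ×ˢ Icc (0 : ℝ) 1 := by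
    ext p; simp [H1]
  rw [this]
  exact uniqueDiffOn_univ.prod (uniqueDiffOn_Icc one_pos)

theorem line_deriv {φ : E × ℝ → E × ℝ} (hφ : ContDiffOn ℝ (⊤ : ℕ∞) φ (H1 E)) (x : E) {s : ℝ}
    (hs : s ∈ Icc (0 : ℝ) 1) :
    HasDerivWithinAt (fun s => φ (x, s)) (fderivWithin ℝ φ (H1 E) (x, s) (0, 1)) (Icc 0 1) s := by
  have h1 : HasFDerivWithinAt φ (fderivWithin ℝ φ (H1 E) (x, s)) (H1 E) (x, s) :=
    (hφ.differentiableOn (by simp) (x, s) hs).hasFDerivWithinAt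
  have h2 : HasDerivWithinAt (fun s : ℝ => (x, s)) ((0 : E), (1 : ℝ)) (Icc 0 1) s :=
    ((hasDerivAt_const s x).prodMk (hasDerivAt_id s)).hasDerivWithinAt
  exact h1.comp_hasDerivWithinAt s h2 (fun r hr => hr)

theorem L_zero {φ : E × ℝ → E × ℝ} (hφ : ContDiffOn ℝ (⊤ : ℕ∞) φ (H1 E))
    (h0 : ∀ x, φ (x, 0) = (x, 0)) (x v : E) :
    fderivWithin ℝ φ (H1 E) (x, 0) (v, 0) = (v, 0) := by
  have h1 : HasFDerivWithinAt φ (fderivWithin ℝ φ (H1 E) (x, 0)) (H1 E) (x, 0) :=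
    (hφ.differentiableOn (by simp) (x, 0) ⟨le_refl _, zero_le_one⟩).hasFDerivWithinAt
  have h2 : HasFDerivAt (fun x : E => (x, (0 : ℝ))) (ContinuousLinearMap.inl ℝ E ℝ) x :=
    hasFDerivAt_prodMk_left x 0
  have h3 := h1.comp x (h2.hasFDerivWithinAt (s := univ))
    (fun y _ => (⟨le_refl (0 : ℝ), zero_le_one⟩ : (y, (0 : ℝ)) ∈ H1 E))
  rw [hasFDerivWithinAt_univ] at h3
  have h4 : (φ ∘ fun x : E => (x, (0 : ℝ))) = fun x : E => (x, (0 : ℝ)) := funext h0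
  rw [h4] at h3
  have h5 := DFunLike.congr_fun (h3.unique h2) v
  simpa using h5

theorem L_pos {φ : E × ℝ → E × ℝ} (hφ : ContDiffOn ℝ (⊤ : ℕ∞) φ (H1 E))
    (h0 : ∀ x, φ (x, 0) = (x, 0)) (hmap : ∀ p : E × ℝ, 0 < p.2 → p.2 < 1 → 0 < (φ p).2)
    (hinj : ∀ x, Function.Injective (fderivWithin ℝ φ (H1 E) (x, 0))) (x : E) :
    0 < (fderivWithin ℝ φ (H1 E) (x, 0) (0, 1)).2 := by
  set L := fderivWithin ℝ φ (H1 E) (x, 0) with hL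
  have hne : (L (0, 1)).2 ≠ 0 := by
    intro h
    have h1 : L ((L (0, 1)).1, 0) = L (0, 1) := by
      rw [hL, L_zero hφ h0, ← hL]
      exact Prod.ext rfl h.symm
    have := congrArg Prod.snd (hinj x h1)
    simp at this
  refine lt_of_le_of_ne ?_ hne.symm
  have h1 := line_deriv hφ x (s := 0) ⟨le_refl _, zero_le_one⟩
  have h2 : HasDerivWithinAt (fun s => (φ (x, s)).2) (L (0, 1)).2 (Icc 0 1) 0 := by
    have h2' : HasFDerivAt (Prod.snd : E × ℝ → ℝ) (ContinuousLinearMap.snd ℝ E ℝ) (φ (x, 0)) :=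
      hasFDerivAt_snd
    have := h2'.comp_hasDerivWithinAt (0 : ℝ) h1
    exact this
  have h3 : HasDerivWithinAt (fun s => (φ (x, s)).2) (L (0, 1)).2 (Ioo 0 1) 0 :=
    h2.mono Ioo_subset_Icc_self
  rw [hasDerivWithinAt_iff_tendsto_slope' (by simp)] at h3
  have : (𝓝[Ioo (0 : ℝ) 1] 0).NeBot := by
    rw [← mem_closure_iff_nhdsWithin_neBot, closure_Ioo (by norm_num)]
    simp
  refine ge_of_tendsto h3 ?_
  filter_upwards [self_mem_nhdsWithin] with s hs
  rw [slope_def_field, h0]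
  have := hmap (x, s) hs.1 hs.2
  simp only [sub_zero]
  exact div_nonneg this.le hs.1.le

variable [FiniteDimensional ℝ E]

theorem exists_Q {δ : E → ℝ} (hδ : ContDiff ℝ (⊤ : ℕ∞) δ) (hδ0 : ∀ x, 0 < δ x)
    (hδ1 : ∀ x, δ x < 1) :
    ∃ Q q, Dif (Ho E) (Ho E) Q q ∧ (∀ p, p.2 ≤ 1 / 3 → Q p = (p.1, δ p.1 * p.2)) ∧
      (∀ p, 2 / 3 ≤ p.2 → Q p = p) := by
  obtain ⟨χ, χ', K, hχ, hχ', hχ0, hχ1, hχa, hχb, hχn, -, -⟩ := exists_chi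
  have hc : ContDiff ℝ (⊤ : ℕ∞)
      (fun p : E × ℝ => p.2 * (δ p.1 * χ p.2 + (1 - χ p.2))) := by
    have := hδ.comp (contDiff_fst (𝕜 := ℝ) (E := E) (F := ℝ) (n := (⊤ : ℕ∞)))
    have h2 := hχ.comp (contDiff_snd (𝕜 := ℝ) (E := E) (F := ℝ) (n := (⊤ : ℕ∞)))
    exact contDiff_snd.mul ((this.mul h2).add (contDiff_const.sub h2))
  have hD := dif_fib (E := E)
    (β := fun p => p.2 * (δ p.1 * χ p.2 + (1 - χ p.2))) hc.contDiffOn ?_ ?_ ?_ ?_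
  · obtain ⟨q, hq⟩ := hD
    refine ⟨_, q, hq, ?_, ?_⟩
    · rintro ⟨x, t⟩ ht
      simp only [hχa t ht, Prod.mk.injEq, true_and]
      ring
    · rintro ⟨x, t⟩ ht
      simp [hχb t ht]
  · rintro ⟨x, t⟩ ht
    refine mul_pos ht ?_
    have h1 := hχ0 t
    have h2 := hχ1 t
    rcases h1.eq_or_lt with h | h
    · simp [← h]
    · have := mul_pos (hδ0 x) h
      simp only; linarith
  · rintro ⟨x, t⟩ ht
    refine mul_le_of_le_one_right (le_of_lt ht) ?_
    have := mul_le_of_le_one_left (hχ0 t) (hδ1 x).le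
    simp only; linarith
  · rintro ⟨x, t⟩ ht
    simp only at ht
    simp [hχb t (by linarith)]
  · rintro ⟨x, t⟩ ht
    have ht : 0 < t := ht
    have h1 := (hc.differentiable (by simp) (x, t)).hasFDerivAt
    have h2 : HasDerivAt (fun t : ℝ => (x, t)) ((0 : E), (1 : ℝ)) t :=
      (hasDerivAt_const t x).prodMk (hasDerivAt_id t)
    have h3 := h1.comp_hasDerivAt t h2
    have h4 : HasDerivAt (fun t : ℝ => t * (δ x * χ t + (1 - χ t)))
        (1 * (δ x * χ t + (1 - χ t)) + t * (δ x * χ' t + (0 - χ' t))) t :=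
      (hasDerivAt_id t).mul (((hχ' t).const_mul (δ x)).add ((hasDerivAt_const t 1).sub (hχ' t)))
    have h5 := h3.unique h4
    rw [h5]
    have a1 : 0 < δ x * χ t + (1 - χ t) := by
      rcases (hχ0 t).eq_or_lt with h | h
      · simp [← h]
      · have := mul_pos (hδ0 x) h
        have := hχ1 t
        linarith
    have a2 : 0 ≤ t * ((1 - δ x) * (- χ' t)) :=
      mul_nonneg ht.le (mul_nonneg (by linarith [hδ1 x]) (by linarith [hχn t]))
    apply ne_of_gt
    linarith

theorem exists_G {φ : E × ℝ → E × ℝ} (hφ : ContDiffOn ℝ (⊤ : ℕ∞) φ (H1 E))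
    (h0 : ∀ x, φ (x, 0) = (x, 0)) (hmap : ∀ p : E × ℝ, 0 < p.2 → p.2 < 1 → 0 < (φ p).2)
    (hinj : ∀ x, Function.Injective (fderivWithin ℝ φ (H1 E) (x, 0))) :
    ∃ δ : E → ℝ, ContDiff ℝ (⊤ : ℕ∞) δ ∧ (∀ x, 0 < δ x) ∧ (∀ x, δ x < 1) ∧
      ∃ G g, Dif (Ho E) (Ho E) G g ∧ ∀ x t, 0 < t → t ≤ 1 / 3 → G (x, t) = φ (x, δ x * t) := by
  obtain ⟨χ, χ', K, hχ, hχ', hχ0, hχ1, hχa, hχb, hχn, hK, hχK⟩ := exists_chi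
  set L := fderivWithin ℝ φ (H1 E) with hLdef
  have hL : ContinuousOn L (H1 E) := hφ.continuousOn_fderivWithin uniqueDiffOn_H1 (by simp)
  obtain ⟨δ, hδ, hδx⟩ := exists_delta (good_mono hK)
    (good_loc hK hL (L_zero hφ h0) (L_pos hφ h0 hmap hinj))
  have hδ0 : ∀ x, 0 < δ x := fun x => (hδx x).1
  have hδ8 : ∀ x, δ x ≤ 1 / 8 := by
    intro x
    obtain ⟨-, η, ⟨C, c, hC, hc, hη, -⟩, hη0, h1, -⟩ := hδx x
    have : 1 ≤ K * C := by nlinarith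
    nlinarith
  refine ⟨δ, hδ, hδ0, fun x => by linarith [hδ8 x], ?_⟩
  -- the rescaled map
  let k : E × ℝ → E × ℝ := fun p => (p.1, δ p.1 * p.2)
  have hk : ContDiff ℝ (⊤ : ℕ∞) k := contDiff_fst.prodMk
    ((hδ.comp contDiff_fst).mul contDiff_snd)
  have hkin : ∀ p : E × ℝ, 0 < p.2 → p.2 < 2 → 0 < (k p).2 ∧ (k p).2 < 1 := by
    intro p hp hp2
    have h1 := hδ0 p.1
    have h2 := hδ8 p.1
    refine ⟨mul_pos h1 hp, ?_⟩
    change δ p.1 * p.2 < 1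
    nlinarith
  have hH1 : ∀ p : E × ℝ, 0 < p.2 → p.2 < 1 → H1 E ∈ 𝓝 p := by
    intro p h1 h2
    filter_upwards [continuous_snd.continuousAt.eventually (Ioo_mem_nhds h1 h2)] with q hq
    exact ⟨hq.1.le, hq.2.le⟩
  have hψc : ∀ p : E × ℝ, 0 < p.2 → p.2 < 2 → ContDiffAt ℝ (⊤ : ℕ∞) (φ ∘ k) p := by
    intro p h1 h2
    obtain ⟨h3, h4⟩ := hkin p h1 h2
    exact (hφ.contDiffAt (hH1 _ h3 h4)).comp p hk.contDiffAt
  have hψd : ∀ p : E × ℝ, 0 < p.2 → p.2 < 2 → HasFDerivAt (φ ∘ k) ((L (k p)).comp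
      ((ContinuousLinearMap.fst ℝ E ℝ).prod (δ p.1 • ContinuousLinearMap.snd ℝ E ℝ +
        p.2 • (fderiv ℝ δ p.1).comp (ContinuousLinearMap.fst ℝ E ℝ)))) p := by
    intro p h1 h2
    obtain ⟨h3, h4⟩ := hkin p h1 h2
    have d1 : HasFDerivAt φ (L (k p)) (k p) :=
      ((hφ.differentiableOn (by simp) (k p) ⟨h3.le, h4.le⟩).hasFDerivWithinAt).hasFDerivAt
        (hH1 _ h3 h4)
    refine d1.comp p ?_
    have d2 : HasFDerivAt (fun p : E × ℝ => δ p.1)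
        ((fderiv ℝ δ p.1).comp (ContinuousLinearMap.fst ℝ E ℝ)) p :=
      ((hδ.differentiable (by simp) p.1).hasFDerivAt).comp p hasFDerivAt_fst
    exact hasFDerivAt_fst.prodMk (d2.mul hasFDerivAt_snd)
  let w : E × ℝ → E := fun p => χ p.2 • ((φ (k p)).1 - p.1)
  let σ : E × ℝ → ℝ := fun p => χ p.2 * (φ (k p)).2 + (1 - χ p.2) * p.2
  have hwfar : ∀ p : E × ℝ, 2 / 3 ≤ p.2 → w p = 0 := fun p hp => by simp [w, hχb _ hp]
  have hσfar : ∀ p : E × ℝ, 2 / 3 ≤ p.2 → σ p = p.2 := fun p hp => by simp [σ, hχb _ hp]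
  have hev : ∀ p : E × ℝ, 2 / 3 < p.2 → ∀ᶠ q in 𝓝 p, 2 / 3 ≤ q.2 := fun p hp => by
    filter_upwards [continuous_snd.continuousAt.eventually (Ioi_mem_nhds hp)] with q hq
    exact le_of_lt hq
  have hχs : ContDiff ℝ (⊤ : ℕ∞) (fun p : E × ℝ => χ p.2) := hχ.comp contDiff_snd
  have hwc : ContDiffOn ℝ (⊤ : ℕ∞) w (Ho E) := by
    intro p hp
    apply ContDiffAt.contDiffWithinAt
    rcases lt_or_ge p.2 1 with h | h
    · exact hχs.contDiffAt.smul (((hψc p hp (by linarith)).fst).sub contDiffAt_fst)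
    · refine (contDiffAt_const (c := (0 : E))).congr_of_eventuallyEq ?_
      filter_upwards [hev p (by linarith)] with q hq
      exact hwfar q hq
  have hσc : ContDiffOn ℝ (⊤ : ℕ∞) σ (Ho E) := by
    intro p hp
    apply ContDiffAt.contDiffWithinAt
    rcases lt_or_ge p.2 1 with h | h
    · exact (hχs.contDiffAt.mul ((hψc p hp (by linarith)).snd)).add
        ((contDiffAt_const.sub hχs.contDiffAt).mul contDiffAt_snd)
    · refine (contDiffAt_snd).congr_of_eventuallyEq ?_
      filter_upwards [hev p (by linarith)] with q hq
      exact hσfar q hq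
  -- pointwise derivative formulas
  have hlin : ∀ p : E × ℝ, ∀ v r, (L (k p)) (v, δ p.1 * r + p.2 * fderiv ℝ δ p.1 v) =
      L (k p) (v, 0) + (δ p.1 * r + p.2 * fderiv ℝ δ p.1 v) • L (k p) (0, 1) := by
    intro p v r
    rw [← map_smul, ← map_add]
    simp
  have hχd : ∀ p : E × ℝ, HasFDerivAt (fun p : E × ℝ => χ p.2)
      (χ' p.2 • ContinuousLinearMap.snd ℝ E ℝ) p := fun p =>
    (hχ' p.2).comp_hasFDerivAt p hasFDerivAt_snd
  have hdw : ∀ p : E × ℝ, 0 < p.2 → p.2 < 2 → ∀ v r, fderiv ℝ w p (v, r) =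
      χ p.2 • ((L (k p) (v, 0) + (δ p.1 * r + p.2 * fderiv ℝ δ p.1 v) • L (k p) (0, 1)).1 - v) +
      (χ' p.2 * r) • ((φ (k p)).1 - p.1) := by
    intro p h1 h2 v r
    have := (hχd p).smul (((hψd p h1 h2).fst).sub hasFDerivAt_fst)
    rw [← hlin]
    have e : HasFDerivAt w _ p := this
    rw [e.fderiv]
    simp
  have hdσ : ∀ p : E × ℝ, 0 < p.2 → p.2 < 2 → ∀ v r, fderiv ℝ σ p (v, r) =
      χ p.2 * (L (k p) (v, 0) + (δ p.1 * r + p.2 * fderiv ℝ δ p.1 v) • L (k p) (0, 1)).2 +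
      χ' p.2 * r * (φ (k p)).2 + (1 - χ p.2) * r - χ' p.2 * r * p.2 := by
    intro p h1 h2 v r
    have := ((hχd p).mul ((hψd p h1 h2).snd)).add (((hχd p).const_sub 1).mul hasFDerivAt_snd)
    rw [← hlin]
    have e : HasFDerivAt σ _ p := this
    rw [e.fderiv]
    simp
    ring
  -- size estimates
  have hest : ∀ (x : E) (C η : ℝ), δ x ≤ η → C * η ≤ 1 → 1 ≤ C →
      (∀ s, 0 ≤ s → s ≤ η → ‖(L (x, s) (0, 1)).1‖ ≤ C ∧ |(L (x, s) (0, 1)).2| ≤ C) →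
      ∀ t, 0 < t → t ≤ 1 → ‖(φ (x, δ x * t)).1 - x‖ ≤ C * (δ x * t) ∧
        |(φ (x, δ x * t)).2| ≤ C * (δ x * t) := by
    intro x C η hδη hCη hC hb t ht0 ht1
    have hη1 : δ x * t ≤ 1 := by
      have := hδ8 x; have := hδ0 x; nlinarith
    have hη2 : δ x * t ≤ η := by
      have := hδ0 x; nlinarith
    have h3 := norm_image_sub_le_of_norm_deriv_le_segment' (f := fun s => φ (x, s)) (a := 0)
      (b := δ x * t) (C := C) (f' := fun s => L (x, s) (0, 1))
      (fun s hs => (line_deriv hφ x ⟨hs.1, hs.2.trans hη1⟩).mono (Icc_subset_Icc_right hη1))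
      (fun s hs => by
        have := hb s hs.1 (hs.2.le.trans hη2)
        rw [Prod.norm_def]
        exact max_le this.1 this.2)
      (δ x * t) ⟨(mul_pos (hδ0 x) ht0).le, le_rfl⟩
    rw [sub_zero, h0] at h3
    refine ⟨(norm_fst_le _).trans h3, ?_⟩
    have := (norm_snd_le _).trans h3
    simpa using this
  have hτ : ∀ p : E × ℝ, 0 < p.2 → p.2 ≤ 1 → (φ (k p)).2 ≤ p.2 := by
    intro p hp h
    obtain ⟨-, η, ⟨C, c, hC, hc, hη, hs⟩, hη0, h1, h2⟩ := hδx p.1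
    have hCη : C * η ≤ 1 := by nlinarith [mul_pos (by linarith : 0 < C) hη0]
    have e3 := (hest p.1 C η h1 hCη hC (fun s hs0 hs1 => by
      obtain ⟨-, b1, -, b2, b3⟩ := hs s hs0 hs1
      exact ⟨b1, abs_le.2 ⟨by linarith, b3⟩⟩) p.2 hp h).2
    refine (le_abs_self _).trans (e3.trans ?_)
    have e4 : C * δ p.1 ≤ 1 := (mul_le_mul_of_nonneg_left h1 (by linarith)).trans hCη
    calc C * (δ p.1 * p.2) = C * δ p.1 * p.2 := by ring
      _ ≤ p.2 := mul_le_of_le_one_left hp.le e4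
  have hD := dif_G (w := w) (σ := σ) hwc hσc ?_ ?_ ?_ ?_ ?_
  · obtain ⟨g, hg⟩ := hD
    refine ⟨_, g, hg, ?_⟩
    intro x t ht ht3
    simp only [w, σ, k, hχa t ht3]
    ext <;> simp
  · -- Lipschitz
    intro p hp v
    rcases le_or_gt p.2 1 with h | h
    · obtain ⟨-, η, ⟨C, c, hC, hc, hη, hs⟩, hη0, h1, h2⟩ := hδx p.1
      have hδp := hδ0 p.1
      have hp : 0 < p.2 := hp
      obtain ⟨s1, s2, -, -, -⟩ := hs (δ p.1 * p.2) (by positivity) (by nlinarith)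
      rw [hdw p hp (by linarith)]
      simp only [mul_zero, zero_add, zero_smul, add_zero]
      rw [norm_smul, Real.norm_of_nonneg (hχ0 _)]
      refine (mul_le_of_le_one_left (norm_nonneg _) (hχ1 _)).trans ?_
      have e1 : (L (k p) (v, 0) + (p.2 * fderiv ℝ δ p.1 v) • L (k p) (0, 1)).1 - v =
          ((L (k p) (v, 0)).1 - v) + (p.2 * fderiv ℝ δ p.1 v) • (L (k p) (0, 1)).1 := by
        simp only [Prod.fst_add, Prod.smul_fst]; abel
      rw [e1]
      have e2 : ‖(p.2 * fderiv ℝ δ p.1 v) • (L (k p) (0, 1)).1‖ ≤ (η * ‖v‖) * C := by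
        rw [norm_smul, norm_mul, Real.norm_of_nonneg hp.le]
        refine mul_le_mul ?_ s2 (norm_nonneg _) (by positivity)
        refine (mul_le_of_le_one_left (norm_nonneg _) h).trans ?_
        exact (ContinuousLinearMap.le_opNorm _ _).trans
          (mul_le_mul_of_nonneg_right h2 (norm_nonneg _))
      have e3 : C * η ≤ 1 / 8 := by nlinarith [mul_pos (by linarith : 0 < C) hη0]
      have e4 : (η * ‖v‖) * C ≤ 1 / 8 * ‖v‖ := by nlinarith [norm_nonneg v]
      have := norm_add_le ((L (k p) (v, 0)).1 - v)
        ((p.2 * fderiv ℝ δ p.1 v) • (L (k p) (0, 1)).1)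
      have s1v : ‖(L (k p) (v, 0)).1 - v‖ ≤ 1 / 4 * ‖v‖ := s1 v
      have := norm_nonneg v
      linarith
    · have : w =ᶠ[𝓝 p] fun _ => (0 : E) := by
        filter_upwards [hev p (by linarith)] with q hq
        exact hwfar q hq
      rw [this.fderiv_eq]
      simp
  · -- positivity
    intro p hp
    have hp : 0 < p.2 := hp
    rcases le_or_gt p.2 1 with h | h
    · obtain ⟨h3, h4⟩ := hkin p hp (by linarith)
      have h5 := hmap (k p) h3 h4
      change 0 < χ p.2 * (φ (k p)).2 + (1 - χ p.2) * p.2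
      have h6 := hχ1 p.2
      rcases (hχ0 p.2).eq_or_lt with h7 | h7
      · rw [← h7]; simpa using hp
      · have := mul_pos h7 h5
        have := mul_nonneg (by linarith : 0 ≤ 1 - χ p.2) hp.le
        linarith
    · rw [hσfar p (by linarith)]
      exact hp
  · intro p hp
    have hp : 0 < p.2 := hp
    rcases le_or_gt p.2 1 with h | h
    · have h2 := hτ p hp h
      change χ p.2 * (φ (k p)).2 + (1 - χ p.2) * p.2 ≤ p.2
      have := mul_le_mul_of_nonneg_left h2 (hχ0 p.2)
      linarith
    · exact (hσfar p (by linarith)).le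
  · intro p hp
    exact hσfar p (by linarith)
  · intro p hp
    have hp : 0 < p.2 := hp
    have d1 : HasFDerivAt w (fderiv ℝ w p) p :=
      ((hwc.contDiffAt (isOpen_Ho.mem_nhds hp)).differentiableAt (by simp)).hasFDerivAt
    have d2 : HasFDerivAt σ (fderiv ℝ σ p) p :=
      ((hσc.contDiffAt (isOpen_Ho.mem_nhds hp)).differentiableAt (by simp)).hasFDerivAt
    have d3 : HasFDerivAt (fun p : E × ℝ => (p.1 + w p, σ p)) _ p :=
      (hasFDerivAt_fst.add d1).prodMk d2
    rw [d3.fderiv, injective_iff_map_eq_zero]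
    rintro ⟨v, r⟩ hvr
    simp only [ContinuousLinearMap.prod_apply, ContinuousLinearMap.coe_fst', Prod.mk_eq_zero,
      add_apply] at hvr
    obtain ⟨e1, e2⟩ := hvr
    rcases le_or_gt p.2 1 with h | h
    · rw [hdw p hp (by linarith)] at e1
      rw [hdσ p hp (by linarith)] at e2
      obtain ⟨-, η, ⟨C, c, hC, hc, hη, hs⟩, hη0, h1, h2⟩ := hδx p.1
      have hδp := hδ0 p.1
      obtain ⟨s1, s2, s3, s4, s5⟩ := hs (δ p.1 * p.2) (by positivity) (by nlinarith)
      have hCη : C * η ≤ 1 := by nlinarith [mul_pos (by linarith : 0 < C) hη0]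
      have e3 := hest p.1 C η h1 hCη hC (fun s hs0 hs1 => by
        obtain ⟨-, b1, -, b2, b3⟩ := hs s hs0 hs1
        exact ⟨b1, abs_le.2 ⟨by linarith, b3⟩⟩) p.2 hp h
      obtain ⟨hv, hr⟩ := inj_alg (u := (φ (k p)).1 - p.1) (τ := (φ (k p)).2)
        hK hC hc hη hδp h1 hp h (hχ0 _) (hχ1 _) (hχn _) (hχK _ hp.le h)
        (s1 v) (s3 v) s2 s4
        ((ContinuousLinearMap.le_opNorm _ _).trans
          (mul_le_mul_of_nonneg_right h2 (norm_nonneg v)))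
        (e3.1.trans (by
          refine mul_le_mul_of_nonneg_left ?_ (by linarith)
          exact mul_le_of_le_one_right hδp.le h))
        (hτ p hp h) e1 e2
      rw [hv, hr]; rfl
    · have a1 : w =ᶠ[𝓝 p] fun _ => (0 : E) := by
        filter_upwards [hev p (by linarith)] with q hq
        exact hwfar q hq
      have a2 : σ =ᶠ[𝓝 p] fun q => q.2 := by
        filter_upwards [hev p (by linarith)] with q hq
        exact hσfar q hq
      rw [a1.fderiv_eq] at e1
      have a3 : HasFDerivAt (fun q : E × ℝ => q.2) (ContinuousLinearMap.snd ℝ E ℝ) p :=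
        hasFDerivAt_snd
      rw [a2.fderiv_eq, a3.fderiv] at e2
      simp at e1 e2
      rw [e1, e2]; rfl
end
end CollarAux

namespace CollarAux

open Set Filter Topology

section
variable {X Y : Type*} [NormedAddCommGroup X] [NormedSpace ℝ X] [NormedAddCommGroup Y]
    [NormedSpace ℝ Y]

theorem compact_of_proper {S : Set X} {f : X → Y} (h : IsProperMap (S.restrict f)) {K : Set Y}
    (hK : IsCompact K) : IsCompact {p | p ∈ S ∧ f p ∈ K} := by
  have := (h.isCompact_preimage hK).image continuous_subtype_val
  convert this using 1
  ext p
  constructor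
  · rintro ⟨h1, h2⟩
    exact ⟨⟨p, h1⟩, h2, rfl⟩
  · rintro ⟨r, hr, rfl⟩
    exact ⟨r.2, hr⟩

theorem closed_of_proper {S A : Set X} {f : X → Y} (h : IsProperMap (S.restrict f))
    (hA : IsClosed A) (hAS : A ⊆ S) : IsClosed (f '' A) := by
  have := h.isClosedMap _ (hA.preimage (continuous_subtype_val (p := fun x => x ∈ S)))
  convert this using 1
  ext y
  constructor
  · rintro ⟨p, hp, rfl⟩
    exact ⟨⟨p, hAS hp⟩, hp, rfl⟩
  · rintro ⟨p, hp, rfl⟩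
    exact ⟨p, hp, rfl⟩

theorem proper_of_compact [FiniteDimensional ℝ Y] {S : Set X} {f : X → Y} (hf : Continuous f)
    (h : ∀ K, IsCompact K → IsCompact {p | p ∈ S ∧ f p ∈ K}) : IsProperMap (S.restrict f) := by
  have : ProperSpace Y := FiniteDimensional.proper ℝ Y
  rw [isProperMap_iff_isCompact_preimage]
  refine ⟨hf.comp continuous_subtype_val, fun {K} hK => ?_⟩
  rw [Subtype.isCompact_iff]
  convert h K hK using 1
  ext p
  constructor
  · rintro ⟨r, hr, rfl⟩
    exact ⟨r.2, hr⟩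
  · rintro ⟨h1, h2⟩
    exact ⟨⟨p, h1⟩, h2, rfl⟩

theorem loc_inv [FiniteDimensional ℝ X] [FiniteDimensional ℝ Y]
    (hdim : Module.finrank ℝ X = Module.finrank ℝ Y)
    {f : X → Y} {x : X} (hc : ContDiffAt ℝ (⊤ : ℕ∞) f x)
    (hd : Function.Injective (fderiv ℝ f x)) :
    ∃ e : OpenPartialHomeomorph X Y, x ∈ e.source ∧ (e : X → Y) = f ∧
      ContDiffAt ℝ (⊤ : ℕ∞) e.symm (f x) := by
  have : CompleteSpace X := FiniteDimensional.complete ℝ X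
  let L : X ≃L[ℝ] Y := (LinearEquiv.ofInjectiveOfFinrankEq (fderiv ℝ f x).toLinearMap
    hd hdim).toContinuousLinearEquiv
  have hL : HasFDerivAt f (L : X →L[ℝ] Y) x := by
    have h1 := (hc.differentiableAt (by simp)).hasFDerivAt
    convert h1 using 1
    ext v
    rfl
  refine ⟨hc.toOpenPartialHomeomorph f hL (by simp), ?_, rfl, ?_⟩
  · exact hc.mem_toOpenPartialHomeomorph_source hL (by simp)
  · exact hc.to_localInverse hL (by simp)

end

section
variable {E : Type*} [NormedAddCommGroup E] [InnerProductSpace ℝ E] [FiniteDimensional ℝ E]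

/-- open strip -/
def Uo (E : Type*) : Set (E × ℝ) := {p | 0 < p.2 ∧ p.2 < 1}

theorem isOpen_Uo {E : Type*} [NormedAddCommGroup E] : IsOpen (Uo E) :=
  (isOpen_lt continuous_const continuous_snd).inter (isOpen_lt continuous_snd continuous_const)

theorem Dif.far {Q q : E × ℝ → E × ℝ} (h : Dif (Ho E) (Ho E) Q q)
    (hQ : ∀ p, 2 / 3 ≤ p.2 → Q p = p) : ∀ p, 2 / 3 ≤ p.2 → q p = p := by
  intro p hp
  have hp' : p ∈ Ho E := lt_of_lt_of_le (by norm_num) hp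
  have := h.li p hp'
  rwa [hQ p hp] at this

theorem Dif.strip {Q q : E × ℝ → E × ℝ} (h : Dif (Ho E) (Ho E) Q q)
    (hQ : ∀ p, 2 / 3 ≤ p.2 → Q p = p) : MapsTo q (Uo E) (Uo E) := by
  intro p hp
  refine ⟨h.mg hp.1, ?_⟩
  by_contra hlt
  have h1 := hQ (q p) (by linarith)
  rw [h.ri p hp.1] at h1
  rw [← h1] at hlt
  exact hlt hp.2

open Classical in
/-- conjugate of `Q` by `φ`, extended by the identity -/
noncomputable def conj (V : Set (E × ℝ)) (φ θ Q : E × ℝ → E × ℝ) (p : E × ℝ) : E × ℝ :=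
  if p ∈ V then φ (Q (θ p)) else p

theorem conj_smooth {V : Set (E × ℝ)} {φ θ Q : E × ℝ → E × ℝ} (hφ : Dif (Uo E) V φ θ)
    (hV : IsOpen V) (hQc : ContDiffOn ℝ (⊤ : ℕ∞) Q (Ho E))
    (hQ : ∀ p, 2 / 3 ≤ p.2 → Q p = p) (hQU : MapsTo Q (Uo E) (Uo E))
    (hcl : ∀ p ∈ Ho E, p ∉ V → ∀ᶠ p' in 𝓝 p, ∀ r : E × ℝ, 0 < r.2 → r.2 ≤ 2 / 3 → φ r ≠ p') :
    ContDiffOn ℝ (⊤ : ℕ∞) (conj V φ θ Q) (Ho E) := by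
  intro p hp
  apply ContDiffAt.contDiffWithinAt
  by_cases hpV : p ∈ V
  · have h1 : ContDiffOn ℝ (⊤ : ℕ∞) (fun p => φ (Q (θ p))) V := by
      have h2 : ContDiffOn ℝ (⊤ : ℕ∞) (Q ∘ θ) V :=
        (hQc.mono (fun p hp => hp.1 : Uo E ⊆ Ho E)).comp hφ.cg hφ.mg
      exact hφ.cf.comp h2 (hQU.comp hφ.mg)
    refine (h1.contDiffAt (hV.mem_nhds hpV)).congr_of_eventuallyEq ?_
    filter_upwards [hV.mem_nhds hpV] with p' hp'
    simp [conj, hp']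
  · refine contDiffAt_id.congr_of_eventuallyEq ?_
    filter_upwards [hcl p hp hpV] with p' hp'
    by_cases hV' : p' ∈ V
    · have h1 : 2 / 3 < (θ p').2 := by
        by_contra hlt
        exact hp' (θ p') (hφ.mg hV').1 (by linarith) (hφ.ri p' hV')
      simp [conj, hV', hQ _ h1.le, hφ.ri p' hV']
    · simp [conj, hV']

theorem conj_inv {V : Set (E × ℝ)} {φ θ Q q : E × ℝ → E × ℝ} (hφ : Dif (Uo E) V φ θ)
    (hQU : MapsTo Q (Uo E) (Uo E)) (hqQ : ∀ p ∈ Uo E, q (Q p) = p) (p : E × ℝ) :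
    conj V φ θ q (conj V φ θ Q p) = p := by
  by_cases hV : p ∈ V
  · have h1 : Q (θ p) ∈ Uo E := hQU (hφ.mg hV)
    have h2 : φ (Q (θ p)) ∈ V := hφ.mf h1
    simp [conj, hV, h2, hφ.li _ h1, hqQ _ (hφ.mg hV), hφ.ri p hV]
  · simp [conj, hV]

theorem conj_maps {V : Set (E × ℝ)} {φ θ Q : E × ℝ → E × ℝ} (hφ : Dif (Uo E) V φ θ)
    (hVH : V ⊆ Ho E) (hQU : MapsTo Q (Uo E) (Uo E)) :
    MapsTo (conj V φ θ Q) (Ho E) (Ho E) := by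
  intro p hp
  by_cases hV : p ∈ V
  · have h1 : Q (θ p) ∈ Uo E := hQU (hφ.mg hV)
    have h2 : φ (Q (θ p)) ∈ V := hφ.mf h1
    simpa [conj, hV] using hVH h2
  · simpa [conj, hV] using hp

theorem dif_conj {V : Set (E × ℝ)} {φ θ Q q : E × ℝ → E × ℝ} (hφ : Dif (Uo E) V φ θ)
    (hV : IsOpen V) (hVH : V ⊆ Ho E) (hD : Dif (Ho E) (Ho E) Q q)
    (hQ : ∀ p, 2 / 3 ≤ p.2 → Q p = p)
    (hcl : ∀ p ∈ Ho E, p ∉ V → ∀ᶠ p' in 𝓝 p, ∀ r : E × ℝ, 0 < r.2 → r.2 ≤ 2 / 3 → φ r ≠ p') :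
    Dif (Ho E) (Ho E) (conj V φ θ q) (conj V φ θ Q) := by
  have hq := hD.far hQ
  have hqU := hD.strip hQ
  have hQU := hD.symm.strip hq
  exact ⟨conj_smooth hφ hV hD.cg hq hqU hcl, conj_smooth hφ hV hD.cf hQ hQU hcl,
    conj_maps hφ hVH hqU, conj_maps hφ hVH hQU,
    fun p _ => conj_inv hφ hqU (fun p hp => hD.ri p hp.1) p,
    fun p _ => conj_inv hφ hQU (fun p hp => hD.li p hp.1) p⟩

/-- The diffeomorphism of the open half space extending the collar `φ`. -/
theorem exists_Phi {φ : E × ℝ → E × ℝ} (hφ : ContDiffOn ℝ (⊤ : ℕ∞) φ (H1 E))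
    (h0 : ∀ x, φ (x, 0) = (x, 0)) (hmap : ∀ p : E × ℝ, 0 < p.2 → p.2 ≤ 1 → 0 < (φ p).2)
    (hinj : InjOn φ (H1 E))
    (hd : ∀ p ∈ H1 E, Function.Injective (fderivWithin ℝ φ (H1 E) p))
    (hcl : ∀ p ∈ Ho E, (∀ r : E × ℝ, 0 < r.2 → r.2 ≤ 2 / 3 → φ r ≠ p) →
      ∀ᶠ p' in 𝓝 p, ∀ r : E × ℝ, 0 < r.2 → r.2 ≤ 2 / 3 → φ r ≠ p') :
    ∃ Φ Ψ, Dif (Ho E) (Ho E) Φ Ψ ∧ ∀ p : E × ℝ, 0 < p.2 → p.2 ≤ 1 / 3 → Φ p = φ p := by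
  have hU1 : Uo E ⊆ H1 E := fun p hp => ⟨hp.1.le, hp.2.le⟩
  obtain ⟨θ, hθ, hV⟩ := dif_of_inj (f := φ) rfl isOpen_Uo (hφ.mono hU1) (hinj.mono hU1) (by
    intro p hp
    have := hd p (hU1 hp)
    rwa [fderivWithin_of_mem_nhds (mem_of_superset (isOpen_Uo.mem_nhds hp) hU1)] at this)
  obtain ⟨δ, hδ, hδ0, hδ1, G, g, hG, hGφ⟩ := exists_G hφ h0
    (fun p h1 h2 => hmap p h1 h2.le) (fun x => hd (x, 0) ⟨le_rfl, zero_le_one⟩)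
  obtain ⟨Q, q, hQ, hQa, hQb⟩ := exists_Q hδ hδ0 hδ1
  have hS := dif_conj hθ hV (by
      rintro _ ⟨p, hp, rfl⟩
      exact hmap p hp.1 hp.2.le) hQ hQb (by
      intro p hp hpV
      refine hcl p hp ?_
      rintro r hr0 hr1 rfl
      exact hpV ⟨r, ⟨hr0, by linarith⟩, rfl⟩)
  refine ⟨_, _, hS.comp hG, ?_⟩
  rintro ⟨x, t⟩ ht ht3
  simp only at ht ht3
  have h1 : (x, δ x * t) ∈ Uo E := by
    refine ⟨mul_pos (hδ0 x) ht, ?_⟩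
    have := hδ0 x
    have := hδ1 x
    simp only
    nlinarith
  have h2 : q (x, δ x * t) = (x, t) := by
    have := hQ.li (x, t) ht
    rwa [hQa (x, t) ht3] at this
  have e : G (x, t) = φ (x, δ x * t) := hGφ x t ht ht3
  change conj _ φ θ q (G (x, t)) = _
  rw [e]
  unfold conj
  rw [if_pos (mem_image_of_mem φ h1), hθ.li _ h1, h2]

theorem collar_main {F : Type*} [NormedAddCommGroup F] [NormedSpace ℝ F] [FiniteDimensional ℝ F]
    (hdim : Module.finrank ℝ (E × ℝ) = Module.finrank ℝ F)
    (i j : E × ℝ → F)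
    (hi_smooth : ContDiff ℝ (⊤ : ℕ∞) i)
    (hi_inj : Set.InjOn i {p | 0 ≤ p.2})
    (hi_proper : IsProperMap (({p : E × ℝ | 0 ≤ p.2}).restrict i))
    (hi_fderiv : ∀ p : E × ℝ, 0 ≤ p.2 → Function.Injective (fderiv ℝ i p))
    (hj_smooth : ContDiff ℝ (⊤ : ℕ∞) j)
    (hj_agree : ∀ x : E, j (x, 0) = i (x, 0))
    (hj_inj : Set.InjOn j {p | 0 ≤ p.2 ∧ p.2 ≤ 1})
    (hj_proper : IsProperMap (({p : E × ℝ | 0 ≤ p.2 ∧ p.2 ≤ 1}).restrict j))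
    (hj_fderiv : ∀ p : E × ℝ, 0 ≤ p.2 → p.2 ≤ 1 → Function.Injective (fderiv ℝ j p))
    (hj_sub : j '' {p | 0 ≤ p.2 ∧ p.2 ≤ 1} ⊆ i '' {p | 0 ≤ p.2})
    (hj_open : ∃ U : Set F, IsOpen U ∧
      j '' {p | 0 ≤ p.2 ∧ p.2 < 1} = U ∩ i '' {p | 0 ≤ p.2}) :
    ∃ i' : E × ℝ → F,
      ContDiff ℝ (⊤ : ℕ∞) i' ∧
      Set.InjOn i' {p | 0 ≤ p.2} ∧
      IsProperMap (({p : E × ℝ | 0 ≤ p.2}).restrict i') ∧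
      (∀ p : E × ℝ, 0 ≤ p.2 → Function.Injective (fderiv ℝ i' p)) ∧
      i' '' {p | 0 ≤ p.2} = i '' {p | 0 ≤ p.2} ∧
      ∃ ε : ℝ, 0 < ε ∧ ∀ (x : E) (t : ℝ), 0 ≤ t → t ≤ ε → i' (x, t) = j (x, t) := by
  classical
  have hex : ∀ p : E × ℝ, ∃ q : E × ℝ, p ∈ H1 E → 0 ≤ q.2 ∧ i q = j p := by
    intro p
    by_cases hp : p ∈ H1 E
    · obtain ⟨q, hq, hqe⟩ := hj_sub ⟨p, hp, rfl⟩
      exact ⟨q, fun _ => ⟨hq, hqe⟩⟩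
    · exact ⟨p, fun h => absurd h hp⟩
  choose φ hφ' using hex
  have hφ0 : ∀ p ∈ H1 E, 0 ≤ (φ p).2 := fun p hp => (hφ' p hp).1
  have hφi : ∀ p ∈ H1 E, i (φ p) = j p := fun p hp => (hφ' p hp).2
  have hcont : ContinuousOn φ (H1 E) := by
    have hemb : IsClosedEmbedding (({p : E × ℝ | 0 ≤ p.2}).restrict i) :=
      IsClosedEmbedding.of_continuous_injective_isClosedMap hi_proper.continuous
        (injOn_iff_injective.1 hi_inj) hi_proper.isClosedMap
    let Φ' : H1 E → {p : E × ℝ | 0 ≤ p.2} := fun p => ⟨φ p, hφ0 p p.2⟩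
    have h1 : Continuous Φ' := by
      rw [hemb.isEmbedding.continuous_iff]
      have : (({p : E × ℝ | 0 ≤ p.2}).restrict i) ∘ Φ' = fun p : H1 E => j p :=
        funext fun p => hφi p p.2
      rw [this]
      exact hj_smooth.continuous.comp continuous_subtype_val
    rw [continuousOn_iff_continuous_restrict]
    exact continuous_subtype_val.comp h1
  have hφc : ContDiffOn ℝ (⊤ : ℕ∞) φ (H1 E) := by
    intro p hp
    obtain ⟨e, he, hei, hec⟩ := loc_inv hdim hi_smooth.contDiffAt (hi_fderiv (φ p) (hφ0 p hp))
    rw [hφi p hp] at hec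
    have h1 : ContDiffAt ℝ (⊤ : ℕ∞) (e.symm ∘ j) p := hec.comp p hj_smooth.contDiffAt
    have h2 : ∀ p' ∈ H1 E, φ p' ∈ e.source → φ p' = e.symm (j p') := by
      intro p' hp' hs
      rw [← hφi p' hp', ← hei, e.left_inv hs]
    refine h1.contDiffWithinAt.congr_of_eventuallyEq ?_ (h2 p hp he)
    filter_upwards [self_mem_nhdsWithin, hcont p hp (e.open_source.mem_nhds he)] with p' hp' hs
    exact h2 p' hp' hs
  have h0 : ∀ x, φ (x, 0) = (x, 0) := by
    intro x
    have hx : (x, (0 : ℝ)) ∈ H1 E := ⟨le_rfl, zero_le_one⟩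
    refine hi_inj (hφ0 _ hx) (le_refl (0 : ℝ)) ?_
    rw [hφi _ hx, hj_agree]
  have hinj : InjOn φ (H1 E) := by
    intro p hp q hq h
    refine hj_inj hp hq ?_
    rw [← hφi p hp, ← hφi q hq, h]
  have hmap : ∀ p : E × ℝ, 0 < p.2 → p.2 ≤ 1 → 0 < (φ p).2 := by
    intro p h1 h2
    refine lt_of_le_of_ne (hφ0 p ⟨h1.le, h2⟩) ?_
    intro h
    have h3 : φ ((φ p).1, 0) = φ p := by
      rw [h0]; exact Prod.ext rfl h
    have h4 := hinj ⟨le_rfl, zero_le_one⟩ ⟨h1.le, h2⟩ h3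
    rw [← h4] at h1
    exact lt_irrefl _ h1
  have hd : ∀ p ∈ H1 E, Function.Injective (fderivWithin ℝ φ (H1 E) p) := by
    intro p hp
    have d1 : HasFDerivWithinAt φ _ (H1 E) p :=
      (hφc.differentiableOn (by simp) p hp).hasFDerivWithinAt
    have d2 : HasFDerivAt i _ (φ p) := (hi_smooth.differentiable (by simp) (φ p)).hasFDerivAt
    have d3 : HasFDerivAt j _ p := (hj_smooth.differentiable (by simp) p).hasFDerivAt
    have d4 := d2.comp_hasFDerivWithinAt p d1
    have d5 : HasFDerivWithinAt (i ∘ φ) (fderiv ℝ j p) (H1 E) p :=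
      d3.hasFDerivWithinAt.congr (fun q hq => hφi q hq) (hφi p hp)
    have d6 := (uniqueDiffOn_H1 p hp).eq d4 d5
    have h7 := hj_fderiv p hp.1 hp.2
    rw [← d6] at h7
    exact Function.Injective.of_comp (f := fderiv ℝ i (φ p)) h7
  have hcl : ∀ p ∈ Ho E, (∀ r : E × ℝ, 0 < r.2 → r.2 ≤ 2 / 3 → φ r ≠ p) →
      ∀ᶠ p' in 𝓝 p, ∀ r : E × ℝ, 0 < r.2 → r.2 ≤ 2 / 3 → φ r ≠ p' := by
    intro p hp hr
    have hcl1 : IsClosed (j '' {p : E × ℝ | 0 ≤ p.2 ∧ p.2 ≤ 2 / 3}) :=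
      closed_of_proper hj_proper
        ((isClosed_le continuous_const continuous_snd).inter
          (isClosed_le continuous_snd continuous_const))
        (fun q hq => ⟨hq.1, by linarith [hq.2]⟩)
    have hcl2 := hcl1.preimage hi_smooth.continuous
    have hpn : p ∈ (i ⁻¹' (j '' {p : E × ℝ | 0 ≤ p.2 ∧ p.2 ≤ 2 / 3}))ᶜ := by
      rintro ⟨r, ⟨hr0, hr1⟩, hre⟩
      have hrH : r ∈ H1 E := ⟨hr0, by linarith⟩
      have h1 : φ r = p := hi_inj (hφ0 r hrH) (show (0:ℝ) ≤ p.2 from le_of_lt hp) (by rw [hφi r hrH, hre])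
      rcases hr0.eq_or_lt with h | h
      · have h2 : r = (r.1, 0) := Prod.ext rfl h.symm
        rw [h2, h0] at h1
        rw [← h1] at hp
        exact lt_irrefl (0:ℝ) (show (0:ℝ) < 0 from hp)
      · exact hr r h hr1 h1
    filter_upwards [hcl2.isOpen_compl.mem_nhds hpn] with p' hp' r hr0 hr1 hre
    refine hp' ⟨r, ⟨hr0.le, hr1⟩, ?_⟩
    rw [← hre, hφi r ⟨hr0.le, by linarith⟩]
  obtain ⟨Φ, Ψ, hD, hΦφ⟩ := exists_Phi hφc h0 hmap hinj hd hcl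
  have hΦj : ∀ p : E × ℝ, 0 < p.2 → p.2 ≤ 1 / 3 → i (Φ p) = j p := by
    intro p h1 h2
    rw [hΦφ p h1 h2, hφi p ⟨h1.le, by linarith⟩]
  let i' : E × ℝ → F := fun p => if p.2 < 1 / 3 then j p else i (Φ p)
  have hA : ∀ p : E × ℝ, p.2 < 1 / 3 → i' p = j p := fun p hp => if_pos hp
  have hB : ∀ p : E × ℝ, 0 < p.2 → i' p = i (Φ p) := by
    intro p hp
    by_cases h : p.2 < 1 / 3
    · rw [hA p h, hΦj p hp h.le]
    · exact if_neg h
  have hEA : ∀ p : E × ℝ, p.2 < 1 / 3 → i' =ᶠ[𝓝 p] j := by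
    intro p hp
    filter_upwards [continuous_snd.continuousAt.eventually (Iio_mem_nhds hp)] with q hq
    exact hA q hq
  have hEB : ∀ p ∈ Ho E, i' =ᶠ[𝓝 p] i ∘ Φ := by
    intro p hp
    filter_upwards [isOpen_Ho.mem_nhds hp] with q hq
    exact hB q hq
  have hΦc : ∀ p ∈ Ho E, ContDiffAt ℝ (⊤ : ℕ∞) Φ p := fun p hp =>
    hD.cf.contDiffAt (isOpen_Ho.mem_nhds hp)
  have hi' : ContDiff ℝ (⊤ : ℕ∞) i' := by
    rw [contDiff_iff_contDiffAt]
    intro p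
    rcases lt_or_ge p.2 (1 / 3) with h | h
    · exact hj_smooth.contDiffAt.congr_of_eventuallyEq (hEA p h)
    · have hp : p ∈ Ho E := lt_of_lt_of_le (by norm_num) h
      exact (hi_smooth.contDiffAt.comp p (hΦc p hp)).congr_of_eventuallyEq (hEB p hp)
  have hi'0 : ∀ p : E × ℝ, p.2 = 0 → i' p = i p := by
    rintro ⟨x, t⟩ rfl
    rw [hA _ (by norm_num), hj_agree]
  have hΦ0 : ∀ p ∈ Ho E, 0 ≤ (Φ p).2 := fun p hp => le_of_lt (hD.mf hp)
  obtain ⟨W, hW, hWj⟩ := hj_open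
  have hJ : IsClosed (j '' {p : E × ℝ | 1 / 6 ≤ p.2 ∧ p.2 ≤ 1}) :=
    closed_of_proper hj_proper
      ((isClosed_le continuous_const continuous_snd).inter
        (isClosed_le continuous_snd continuous_const))
      (fun q hq => ⟨by linarith [hq.1], hq.2⟩)
  set J := j '' {p : E × ℝ | 1 / 6 ≤ p.2 ∧ p.2 ≤ 1} with hJdef
  -- the small collar is relatively open
  have hsmall : ∀ r : E × ℝ, 0 ≤ r.2 → r.2 < 1 / 6 → j r ∈ W \ J := by
    intro r hr0 hr1
    have h1 : j r ∈ W ∩ i '' {p | 0 ≤ p.2} := by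
      rw [← hWj]
      exact ⟨r, ⟨hr0, by linarith⟩, rfl⟩
    refine ⟨h1.1, ?_⟩
    rintro ⟨s, ⟨hs0, hs1⟩, hse⟩
    have := hj_inj ⟨by linarith, hs1⟩ ⟨hr0, by linarith⟩ hse
    rw [this] at hs0
    linarith
  have hsmall' : ∀ q : E × ℝ, 0 ≤ q.2 → i q ∈ W \ J → ∃ r : E × ℝ, 0 ≤ r.2 ∧ r.2 < 1 / 6 ∧
      j r = i q := by
    intro q hq hqW
    have h1 : i q ∈ W ∩ i '' {p | 0 ≤ p.2} := ⟨hqW.1, q, hq, rfl⟩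
    rw [← hWj] at h1
    obtain ⟨r, ⟨hr0, hr1⟩, hre⟩ := h1
    refine ⟨r, hr0, ?_, hre⟩
    by_contra hlt
    exact hqW.2 ⟨r, ⟨by linarith, hr1.le⟩, hre⟩
  refine ⟨i', hi', ?_, ?_, ?_, ?_, 1 / 6, by norm_num, ?_⟩
  · intro p hp q hq h
    have hp : 0 ≤ p.2 := hp
    have hq : 0 ≤ q.2 := hq
    rcases hp.eq_or_lt with h1 | h1 <;> rcases hq.eq_or_lt with h2 | h2
    · rw [hi'0 p h1.symm, hi'0 q h2.symm] at h
      exact hi_inj hp hq h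
    · rw [hi'0 p h1.symm, hB q h2] at h
      have h3 := hi_inj hp (hΦ0 q h2) h
      have h4 : 0 < (Φ q).2 := hD.mf h2
      rw [← h3, ← h1] at h4
      exact absurd h4 (lt_irrefl _)
    · rw [hi'0 q h2.symm, hB p h1] at h
      have h3 := hi_inj (hΦ0 p h1) hq h
      have h4 : 0 < (Φ p).2 := hD.mf h1
      rw [h3, ← h2] at h4
      exact absurd h4 (lt_irrefl _)
    · rw [hB p h1, hB q h2] at h
      have h3 := hi_inj (hΦ0 p h1) (hΦ0 q h2) h
      rw [← hD.li p h1, h3, hD.li q h2]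
  · refine proper_of_compact hi'.continuous ?_
    intro K hK
    have hKi := compact_of_proper hi_proper hK
    have hKj := compact_of_proper hj_proper hK
    have hC : IsCompact ({p | p ∈ {p : E × ℝ | 0 ≤ p.2} ∧ i p ∈ K} ∩ (i ⁻¹' (W \ J))ᶜ) :=
      hKi.inter_right (((hW.sdiff hJ).preimage hi_smooth.continuous).isClosed_compl)
    set C := {p | p ∈ {p : E × ℝ | 0 ≤ p.2} ∧ i p ∈ K} ∩ (i ⁻¹' (W \ J))ᶜ with hCdef
    have hCH : C ⊆ Ho E := by
      rintro c ⟨⟨hc0, hcK⟩, hcn⟩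
      have hc0 : 0 ≤ c.2 := hc0
      refine lt_of_le_of_ne hc0 ?_
      intro h
      apply hcn
      have h2 : c = (c.1, 0) := Prod.ext rfl h.symm
      have h3 := hsmall c hc0 (by rw [← h]; norm_num)
      rw [h2, hj_agree, ← h2] at h3
      exact h3
    have hBc := hC.image_of_continuousOn (hD.cg.continuousOn.mono hCH)
    have hAc := hKj.inter_right (isClosed_le (continuous_snd (X := E) (Y := ℝ))
      (continuous_const (y := (1 / 6 : ℝ))))
    convert hAc.union hBc using 1
    ext p
    constructor
    · rintro ⟨hp0, hpK⟩
      have hp0 : 0 ≤ p.2 := hp0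
      rcases le_or_gt p.2 (1 / 6) with h | h
      · left
        rw [hA p (by linarith)] at hpK
        exact ⟨⟨⟨hp0, by linarith⟩, hpK⟩, h⟩
      · right
        have hp : p ∈ Ho E := lt_trans (by norm_num) h
        rw [hB p hp] at hpK
        refine ⟨Φ p, ⟨⟨hΦ0 p hp, hpK⟩, ?_⟩, hD.li p hp⟩
        intro hW'
        obtain ⟨r, hr0, hr1, hre⟩ := hsmall' _ (hΦ0 p hp) hW'
        rcases hr0.eq_or_lt with h1 | h1
        · have h2 : r = (r.1, 0) := Prod.ext rfl h1.symm
          rw [h2, hj_agree] at hre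
          have h3 := hi_inj (le_refl (0 : ℝ)) (hΦ0 p hp) hre
          have h4 : 0 < (Φ p).2 := hD.mf hp
          rw [← h3] at h4
          exact lt_irrefl _ h4
        · rw [← hΦj r h1 (by linarith)] at hre
          have h3 := hi_inj (hΦ0 r h1) (hΦ0 p hp) hre
          have h4 : r = p := by rw [← hD.li r h1, h3, hD.li p hp]
          rw [h4] at hr1
          linarith
    · rintro (⟨⟨⟨hp0, hp1⟩, hpK⟩, hp6⟩ | ⟨c, hc, rfl⟩)
      · have hp6 : p.2 ≤ 1 / 6 := hp6
        refine ⟨hp0, ?_⟩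
        rw [hA p (by linarith)]
        exact hpK
      · have h1 : Ψ c ∈ Ho E := hD.mg (hCH hc)
        refine ⟨(show (0:ℝ) ≤ (Ψ c).2 from le_of_lt h1), ?_⟩
        rw [hB _ h1, hD.ri c (hCH hc)]
        exact hc.1.2
  · intro p hp
    rcases lt_or_ge p.2 (1 / 3) with h | h
    · rw [(hEA p h).fderiv_eq]
      exact hj_fderiv p hp (by linarith)
    · have hp : p ∈ Ho E := lt_of_lt_of_le (by norm_num) h
      rw [(hEB p hp).fderiv_eq, fderiv_comp p (hi_smooth.differentiable (by simp) _)
        ((hΦc p hp).differentiableAt (by simp))]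
      exact (hi_fderiv _ (hΦ0 p hp)).comp (hD.fderiv_inj isOpen_Ho isOpen_Ho hp)
  · apply Subset.antisymm
    · rintro _ ⟨p, hp, rfl⟩
      have hp : 0 ≤ p.2 := hp
      rcases hp.eq_or_lt with h1 | h1
      · exact ⟨p, hp, (hi'0 p h1.symm).symm⟩
      · exact ⟨Φ p, hΦ0 p h1, (hB p h1).symm⟩
    · rintro _ ⟨p, hp, rfl⟩
      have hp : 0 ≤ p.2 := hp
      rcases hp.eq_or_lt with h1 | h1
      · exact ⟨p, hp, hi'0 p h1.symm⟩
      · refine ⟨Ψ p, (show (0:ℝ) ≤ (Ψ p).2 from le_of_lt (hD.mg h1)), ?_⟩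
        rw [hB _ (hD.mg h1), hD.ri p h1]
  · intro x t ht0 ht1
    exact hA (x, t) (by simp only; linarith)

end
end CollarAux

/-- Proposition 12.4 (uniqueness of collars): a proper smooth embedding of the half-space
`H = ℝ^m × ℝ₊` can be reparametrized, keeping its image, so as to agree near the boundary
with a given collar neighborhood `j` of its boundary. -/
theorem collar_reparametrization (m : ℕ) (hm : 1 ≤ m)
    (i j : EuclideanSpace ℝ (Fin m) × ℝ → EuclideanSpace ℝ (Fin (m + 1)))
    (hi_smooth : ContDiff ℝ (⊤ : ℕ∞) i)
    (hi_inj : Set.InjOn i {p | 0 ≤ p.2})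
    (hi_proper : IsProperMap (({p : EuclideanSpace ℝ (Fin m) × ℝ | 0 ≤ p.2}).restrict i))
    (hi_fderiv : ∀ p : EuclideanSpace ℝ (Fin m) × ℝ, 0 ≤ p.2 →
      Function.Injective (fderiv ℝ i p))
    (hj_smooth : ContDiff ℝ (⊤ : ℕ∞) j)
    (hj_agree : ∀ x : EuclideanSpace ℝ (Fin m), j (x, 0) = i (x, 0))
    (hj_inj : Set.InjOn j {p | 0 ≤ p.2 ∧ p.2 ≤ 1})
    (hj_proper : IsProperMap
      (({p : EuclideanSpace ℝ (Fin m) × ℝ | 0 ≤ p.2 ∧ p.2 ≤ 1}).restrict j))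
    (hj_fderiv : ∀ p : EuclideanSpace ℝ (Fin m) × ℝ, 0 ≤ p.2 → p.2 ≤ 1 →
      Function.Injective (fderiv ℝ j p))
    (hj_sub : j '' {p | 0 ≤ p.2 ∧ p.2 ≤ 1} ⊆ i '' {p | 0 ≤ p.2})
    (hj_open : ∃ U : Set (EuclideanSpace ℝ (Fin (m + 1))), IsOpen U ∧
      j '' {p | 0 ≤ p.2 ∧ p.2 < 1} = U ∩ i '' {p | 0 ≤ p.2}) :
    ∃ i' : EuclideanSpace ℝ (Fin m) × ℝ → EuclideanSpace ℝ (Fin (m + 1)),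
      ContDiff ℝ (⊤ : ℕ∞) i' ∧
      Set.InjOn i' {p | 0 ≤ p.2} ∧
      IsProperMap (({p : EuclideanSpace ℝ (Fin m) × ℝ | 0 ≤ p.2}).restrict i') ∧
      (∀ p : EuclideanSpace ℝ (Fin m) × ℝ, 0 ≤ p.2 →
        Function.Injective (fderiv ℝ i' p)) ∧
      i' '' {p | 0 ≤ p.2} = i '' {p | 0 ≤ p.2} ∧
      ∃ ε : ℝ, 0 < ε ∧ ∀ (x : EuclideanSpace ℝ (Fin m)) (t : ℝ), 0 ≤ t → t ≤ ε →
        i' (x, t) = j (x, t) := by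
  exact CollarAux.collar_main (by simp [Module.finrank_prod]) i j hi_smooth hi_inj hi_proper
    hi_fderiv hj_smooth hj_agree hj_inj hj_proper hj_fderiv hj_sub hj_open
end

section
/- Let f : ℝⁿ → ℝ^m be a polynomial map, i.e., there exist polynomials f₁, …, f_m ∈ MvPolynomial (Fin n) ℝ such that f(x) = (eval x f₁, …, eval x f_m) for all x. If V ⊆ ℝⁿ is semialgebraic, then the image f '' V ⊆ ℝ^m is semialgebraic. -/
/-- Semialgebraic subsets of `ℝᵏ`: the smallest Boolean algebra of subsets containing the
sets `{x | g(x) > 0}` for all polynomials `g`. -/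
inductive IsSemialgebraic : {k : ℕ} → Set (Fin k → ℝ) → Prop
  | basic {k : ℕ} (g : MvPolynomial (Fin k) ℝ) :
      IsSemialgebraic {x : Fin k → ℝ | 0 < MvPolynomial.eval x g}
  | compl {k : ℕ} {s : Set (Fin k → ℝ)} : IsSemialgebraic s → IsSemialgebraic sᶜ
  | union {k : ℕ} {s t : Set (Fin k → ℝ)} :
      IsSemialgebraic s → IsSemialgebraic t → IsSemialgebraic (s ∪ t)

namespace TS
open Polynomial Set

/-- A polynomial without roots on a segment has the same sign at both ends. -/
lemma sign_const (g : ℝ[X]) (a b : ℝ) (h : ∀ z ∈ uIcc a b, g.eval z ≠ 0) :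
    SignType.sign (g.eval a) = SignType.sign (g.eval b) := by
  have hiv := intermediate_value_uIcc (f := fun t => g.eval t) (a := a) (b := b)
    g.continuous.continuousOn
  have ha := h a left_mem_uIcc
  have hb := h b right_mem_uIcc
  have key : (0 : ℝ) ∉ uIcc (g.eval a) (g.eval b) := by
    intro h0
    obtain ⟨z, hz, hz0⟩ := hiv h0
    exact h z hz hz0
  rcases lt_or_gt_of_ne ha with h1 | h1 <;> rcases lt_or_gt_of_ne hb with h2 | h2
  · rw [sign_neg h1, sign_neg h2]
  · exact absurd (mem_uIcc.2 (Or.inl ⟨h1.le, h2.le⟩)) key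
  · exact absurd (mem_uIcc.2 (Or.inr ⟨h2.le, h1.le⟩)) key
  · rw [sign_pos h1, sign_pos h2]

lemma mvt (g : ℝ[X]) (a b : ℝ) (hab : a < b) :
    ∃ c ∈ Ioo a b, g.eval b - g.eval a = g.derivative.eval c * (b - a) := by
  obtain ⟨c, hc, h⟩ := exists_hasDerivAt_eq_slope (fun t => g.eval t)
    (fun t => g.derivative.eval t) hab g.continuous.continuousOn
    (fun x _ => g.hasDerivAt x)
  refine ⟨c, hc, ?_⟩
  have : b - a ≠ 0 := by linarith
  rw [h]; field_simp

/-- Sign of `g` near a root in a region where the derivative does not vanish. -/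
lemma sign_of_root (g : ℝ[X]) (w t : ℝ) (hw : g.eval w = 0)
    (h : ∀ z ∈ uIcc w t, g.derivative.eval z ≠ 0) :
    SignType.sign (g.eval t) =
      SignType.sign (g.derivative.eval t) * SignType.sign (t - w) := by
  rcases lt_trichotomy w t with hwt | rfl | hwt
  · obtain ⟨c, hc, h1⟩ := mvt g w t hwt
    have : SignType.sign (g.derivative.eval c) = SignType.sign (g.derivative.eval t) := by
      apply sign_const
      intro z hz
      apply h z
      rw [uIcc_of_le hc.2.le] at hz
      rw [uIcc_of_le hwt.le]
      exact ⟨hc.1.le.trans hz.1, hz.2⟩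
    rw [← this, ← sign_mul, ← h1, hw, sub_zero]
  · simp [hw]
  · obtain ⟨c, hc, h1⟩ := mvt g t w hwt
    have : SignType.sign (g.derivative.eval c) = SignType.sign (g.derivative.eval t) := by
      apply sign_const
      intro z hz
      apply h z
      rw [uIcc_of_ge hc.1.le] at hz
      rw [uIcc_of_ge hwt.le]
      exact ⟨hz.1, hz.2.trans hc.2.le⟩
    rw [← this, ← sign_mul]
    congr 1
    linarith

/-- Uniqueness of a root where the derivative does not vanish. -/
lemma root_unique (g : ℝ[X]) (w t : ℝ) (hw : g.eval w = 0) (ht : g.eval t = 0)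
    (h : ∀ z ∈ uIcc w t, g.derivative.eval z ≠ 0) : w = t := by
  have := sign_of_root g w t hw h
  rw [ht, sign_zero, ← sign_mul] at this
  have h2 := sign_eq_zero_iff.1 this.symm
  rcases mul_eq_zero.1 h2 with h3 | h3
  · exact absurd h3 (h t right_mem_uIcc)
  · linarith

lemma root_right (g : ℝ[X]) (hd : 0 < g.degree) (u : ℝ) (hu : 0 < g.eval u)
    (h : ∀ z, u ≤ z → g.derivative.eval z < 0) : ∃ v, u < v ∧ g.eval v = 0 := by
  have ht := Polynomial.abs_tendsto_atTop g hd
  obtain ⟨t, h1, h2⟩ := ((ht.eventually (Filter.eventually_gt_atTop (g.eval u))).and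
    (Filter.eventually_gt_atTop u)).exists
  obtain ⟨c, hc, h3⟩ := mvt g u t h2
  have h4 := h c hc.1.le
  have h5 : g.eval t < g.eval u := by nlinarith
  have h6 : g.eval t < 0 := by
    by_contra h7
    rw [abs_of_nonneg (not_lt.1 h7)] at h1
    linarith
  obtain ⟨v, hv, hv0⟩ := intermediate_value_Icc' (f := fun t => g.eval t) h2.le
    g.continuous.continuousOn ⟨h6.le, hu.le⟩
  refine ⟨v, lt_of_le_of_ne hv.1 ?_, hv0⟩
  rintro rfl
  simp only at hv0
  linarith

lemma root_left (g : ℝ[X]) (hd : 0 < g.degree) (u : ℝ) (hu : 0 < g.eval u)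
    (h : ∀ z, z ≤ u → 0 < g.derivative.eval z) : ∃ v, v < u ∧ g.eval v = 0 := by
  obtain ⟨v, hv, hv0⟩ := root_right (g.comp (-X)) (by
    rw [← natDegree_pos_iff_degree_pos] at hd ⊢
    simpa [natDegree_comp] using hd) (-u) (by simpa using hu) (by
    intro z hz
    have := h (-z) (by linarith)
    simpa [derivative_comp] using this)
  exact ⟨-v, by linarith, by simpa using hv0⟩

/-- `φ` matches the derivatives of `p` and `q`, and the signs of `p` and `q` on `S`. -/
structure Good (φ : ℝ ≃o ℝ) (S : Set ℝ) (p q : ℝ[X]) : Prop where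
  fin : S.Finite
  degp : 0 < p.degree
  degq : 0 < q.degree
  root : ∀ t, p.derivative.eval t = 0 → t ∈ S
  der : ∀ t, SignType.sign (p.derivative.eval t) = SignType.sign (q.derivative.eval (φ t))
  sgn : ∀ s ∈ S, SignType.sign (p.eval s) = SignType.sign (q.eval (φ s))

lemma Good.symm {φ : ℝ ≃o ℝ} {S : Set ℝ} {p q : ℝ[X]} (h : Good φ S p q) :
    Good φ.symm (φ '' S) q p where
  fin := h.fin.image _
  degp := h.degq
  degq := h.degp
  root t ht := by
    have := h.der (φ.symm t)
    rw [φ.apply_symm_apply, ht, sign_zero, sign_eq_zero_iff] at this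
    exact ⟨_, h.root _ this, φ.apply_symm_apply t⟩
  der t := by
    have := h.der (φ.symm t)
    rw [φ.apply_symm_apply] at this
    exact this.symm
  sgn := by
    rintro _ ⟨s, hs, rfl⟩
    rw [φ.symm_apply_apply]
    exact (h.sgn s hs).symm

lemma Good.neg {φ : ℝ ≃o ℝ} {S : Set ℝ} {p q : ℝ[X]} (h : Good φ S p q) :
    Good φ S (-p) (-q) where
  fin := h.fin
  degp := by rw [degree_neg]; exact h.degp
  degq := by rw [degree_neg]; exact h.degq
  root t ht := h.root t (by simpa using ht)
  der t := by
    have := h.der t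
    simp only [derivative_neg, eval_neg, Left.sign_neg, this]
  sgn s hs := by
    simp only [eval_neg, Left.sign_neg, h.sgn s hs]

lemma Good.exists_pos {φ : ℝ ≃o ℝ} {S : Set ℝ} {p q : ℝ[X]} (h : Good φ S p q)
    (t : ℝ) (ht : t ∉ S) (hp : p.eval t ≤ 0) (hq : 0 < q.eval (φ t)) :
    ∃ v, q.eval v = 0 ∧ ∀ z ∈ uIcc (φ t) v, z ∉ φ '' S := by
  have hd : p.derivative.eval t ≠ 0 := fun h0 => ht (h.root t h0)
  rcases lt_or_gt_of_ne hd with hd | hd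
  · -- go right
    have hneg : ∀ c, t ≤ c → (∀ z ∈ Icc t c, z ∉ S) → p.derivative.eval c < 0 := by
      intro c hc hz
      have := sign_const p.derivative t c (by
        intro z hz' h0
        rw [uIcc_of_le hc] at hz'
        exact hz z hz' (h.root z h0))
      rw [sign_neg hd] at this
      exact sign_eq_neg_one_iff.1 this.symm
    by_cases hS : (S ∩ Ioi t).Nonempty
    · obtain ⟨s, ⟨hsS, hst⟩, hmin⟩ :=
        Set.exists_min_image (S ∩ Ioi t) id (h.fin.inter_of_left _) hS
      have hfree : ∀ z, t ≤ z → z < s → z ∉ S := by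
        intro z h1 h2 hz
        rcases h1.eq_or_lt with rfl | h1
        · exact ht hz
        · exact absurd (hmin z ⟨hz, h1⟩) (not_le.2 h2)
      obtain ⟨c, hc, h3⟩ := mvt p t s hst
      have h4 := hneg c hc.1.le (fun z hz => hfree z hz.1 (hz.2.trans_lt hc.2))
      have hst' : t < s := hst
      have h5 : p.eval s < 0 := by nlinarith
      have h6 : q.eval (φ s) < 0 := by
        have := h.sgn s hsS
        rw [sign_neg h5] at this
        exact sign_eq_neg_one_iff.1 this.symm
      have h7 : φ t < φ s := φ.lt_iff_lt.2 hst
      obtain ⟨v, hv, hv0⟩ := intermediate_value_Icc' (f := fun t => q.eval t) h7.le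
        q.continuous.continuousOn ⟨h6.le, hq.le⟩
      simp only at hv0
      have hvs : v < φ s := lt_of_le_of_ne hv.2 (by rintro rfl; linarith)
      refine ⟨v, hv0, ?_⟩
      rw [uIcc_of_le hv.1]
      rintro _ hz ⟨z, hzS, rfl⟩
      exact hfree z (φ.le_iff_le.1 hz.1) (φ.lt_iff_lt.1 (hz.2.trans_lt hvs)) hzS
    · have hfree : ∀ z, t ≤ z → z ∉ S := by
        intro z h1 hz
        rcases h1.eq_or_lt with rfl | h1
        · exact ht hz
        · exact hS ⟨z, hz, h1⟩
      obtain ⟨v, hv, hv0⟩ := root_right q h.degq (φ t) hq (by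
        intro z hz
        have h1 : t ≤ φ.symm z := φ.le_symm_apply.2 hz
        have h2 := hneg _ h1 (fun z hz => hfree z hz.1)
        have := h.der (φ.symm z)
        rw [φ.apply_symm_apply, sign_neg h2] at this
        exact sign_eq_neg_one_iff.1 this.symm)
      refine ⟨v, hv0, ?_⟩
      rw [uIcc_of_le hv.le]
      rintro _ hz ⟨z, hzS, rfl⟩
      exact hfree z (φ.le_iff_le.1 hz.1) hzS
  · -- go left
    have hneg : ∀ c, c ≤ t → (∀ z ∈ Icc c t, z ∉ S) → 0 < p.derivative.eval c := by
      intro c hc hz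
      have := sign_const p.derivative t c (by
        intro z hz' h0
        rw [uIcc_of_ge hc] at hz'
        exact hz z hz' (h.root z h0))
      rw [sign_pos hd] at this
      exact sign_eq_one_iff.1 this.symm
    by_cases hS : (S ∩ Iio t).Nonempty
    · obtain ⟨s, ⟨hsS, hst⟩, hmin⟩ :=
        Set.exists_max_image (S ∩ Iio t) id (h.fin.inter_of_left _) hS
      have hfree : ∀ z, z ≤ t → s < z → z ∉ S := by
        intro z h1 h2 hz
        rcases h1.eq_or_lt with rfl | h1
        · exact ht hz
        · exact absurd (hmin z ⟨hz, h1⟩) (not_le.2 h2)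
      obtain ⟨c, hc, h3⟩ := mvt p s t hst
      have h4 := hneg c hc.2.le (fun z hz => hfree z hz.2 (hc.1.trans_le hz.1))
      have hst' : s < t := hst
      have h5 : p.eval s < 0 := by nlinarith
      have h6 : q.eval (φ s) < 0 := by
        have := h.sgn s hsS
        rw [sign_neg h5] at this
        exact sign_eq_neg_one_iff.1 this.symm
      have h7 : φ s < φ t := φ.lt_iff_lt.2 hst
      obtain ⟨v, hv, hv0⟩ := intermediate_value_Icc (f := fun t => q.eval t) h7.le
        q.continuous.continuousOn ⟨h6.le, hq.le⟩
      simp only at hv0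
      have hvs : φ s < v := lt_of_le_of_ne hv.1 (by rintro rfl; linarith)
      refine ⟨v, hv0, ?_⟩
      rw [uIcc_of_ge hv.2]
      rintro _ hz ⟨z, hzS, rfl⟩
      exact hfree z (φ.le_iff_le.1 hz.2) (φ.lt_iff_lt.1 (hvs.trans_le hz.1)) hzS
    · have hfree : ∀ z, z ≤ t → z ∉ S := by
        intro z h1 hz
        rcases h1.eq_or_lt with rfl | h1
        · exact ht hz
        · exact hS ⟨z, hz, h1⟩
      obtain ⟨v, hv, hv0⟩ := root_left q h.degq (φ t) hq (by
        intro z hz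
        have h1 : φ.symm z ≤ t := φ.symm_apply_le.2 hz
        have h2 := hneg _ h1 (fun z hz => hfree z hz.2)
        have := h.der (φ.symm z)
        rw [φ.apply_symm_apply, sign_pos h2] at this
        exact sign_eq_one_iff.1 this.symm)
      refine ⟨v, hv0, ?_⟩
      rw [uIcc_of_ge hv.le]
      rintro _ hz ⟨z, hzS, rfl⟩
      exact hfree z (φ.le_iff_le.1 hz.2) hzS

lemma Good.exists_root {φ : ℝ ≃o ℝ} {S : Set ℝ} {p q : ℝ[X]} (h : Good φ S p q)
    (t : ℝ) (hne : SignType.sign (p.eval t) ≠ SignType.sign (q.eval (φ t))) :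
    ∃ v, q.eval v = 0 ∧ ∀ z ∈ uIcc (φ t) v, z ∉ φ '' S := by
  have ht : t ∉ S := fun hs => hne (h.sgn t hs)
  rcases lt_trichotomy (q.eval (φ t)) 0 with hq | hq | hq
  · have hp : 0 ≤ p.eval t := by
      by_contra hp
      exact hne (by rw [sign_neg hq, sign_neg (not_le.1 hp)])
    obtain ⟨v, hv, hz⟩ := h.neg.exists_pos t ht (by simpa using hp) (by simpa using hq)
    exact ⟨v, by simpa using hv, hz⟩
  · refine ⟨φ t, hq, ?_⟩
    rw [uIcc_self]
    rintro _ rfl ⟨s, hs, hst⟩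
    exact ht (φ.injective hst ▸ hs)
  · have hp : p.eval t ≤ 0 := by
      by_contra hp
      exact hne (by rw [sign_pos hq, sign_pos (not_le.1 hp)])
    exact h.exists_pos t ht hp hq

/-- Bump order isomorphism, upward. -/
lemma bump_up (a b u v : ℝ) (h1 : a < u) (h2 : u ≤ v) (h3 : v < b) :
    ∃ η : ℝ ≃o ℝ, η u = v ∧ ∀ z, z ∉ Icc a b → η z = z := by
  set α := (v - a) / (u - a) with hα
  set β := (b - v) / (b - u) with hβ
  have e1 : α * (u - a) = v - a := by
    have : u - a ≠ 0 := by linarith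
    rw [hα]; field_simp
  have e2 : β * (b - u) = b - v := by
    have : b - u ≠ 0 := by linarith
    rw [hβ]; field_simp
  have ha : 1 ≤ α := by rw [hα, le_div_iff₀ (by linarith)]; linarith
  have hb0 : 0 < β := div_pos (by linarith) (by linarith)
  have hb1 : β ≤ 1 := by rw [hβ, div_le_iff₀ (by linarith)]; linarith
  let f : ℝ → ℝ := fun t => max t (min (a + α * (t - a)) (b - β * (b - t)))
  have hf : StrictMono f := by
    intro s t hst
    refine max_lt_max hst (min_lt_min ?_ ?_)
    · nlinarith
    · nlinarith
  have hfix : ∀ z, z ∉ Icc a b → f z = z := by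
    intro z hz
    apply max_eq_left
    by_cases hza : z < a
    · apply min_le_of_left_le
      nlinarith
    · have : b < z := by
        by_contra hzb
        exact hz ⟨not_lt.1 hza, not_lt.1 hzb⟩
      apply min_le_of_right_le
      nlinarith
  have hfu : f u = v := by
    simp only [f, e1, e2]
    simp [h2]
  have hc : Continuous f := by fun_prop
  have hs : Function.Surjective f := by
    apply hc.surjective
    · exact Filter.tendsto_atTop_mono (fun t => le_max_left _ _) Filter.tendsto_id
    · apply Filter.Tendsto.congr' _ Filter.tendsto_id
      filter_upwards [Filter.eventually_lt_atBot a] with z hz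
      exact (hfix z (fun h => absurd h.1 (not_le.2 hz))).symm
  exact ⟨hf.orderIsoOfSurjective f hs, hfu, hfix⟩

lemma bump (a b u v : ℝ) (h1 : a < u) (h2 : a < v) (h3 : u < b) (h4 : v < b) :
    ∃ η : ℝ ≃o ℝ, η u = v ∧ ∀ z, z ∉ Icc a b → η z = z := by
  rcases le_total u v with h | h
  · exact bump_up a b u v h1 h h4
  · obtain ⟨η, e1, e2⟩ := bump_up a b v u h2 h h3
    refine ⟨η.symm, ?_, ?_⟩
    · rw [← e1, η.symm_apply_apply]
    · intro z hz
      rw [OrderIso.symm_apply_eq, e2 z hz]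

/-- A segment missing a finite set can be enlarged. -/
lemma enlarge (S : Set ℝ) (hS : S.Finite) (u v : ℝ) (h : ∀ z ∈ uIcc u v, z ∉ S) :
    ∃ a b, a < u ∧ a < v ∧ u < b ∧ v < b ∧ ∀ z ∈ Icc a b, z ∉ S := by
  have hcl : IsClosed S := hS.isClosed
  have hu : Sᶜ ∈ nhds (min u v) := hcl.isOpen_compl.mem_nhds (h _ ⟨le_rfl, min_le_max⟩)
  have hv : Sᶜ ∈ nhds (max u v) := hcl.isOpen_compl.mem_nhds (h _ ⟨min_le_max, le_rfl⟩)
  obtain ⟨ε, hε, h1⟩ := Metric.mem_nhds_iff.1 hu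
  obtain ⟨δ, hδ, h2⟩ := Metric.mem_nhds_iff.1 hv
  have m1 := min_le_left u v
  have m2 := min_le_right u v
  have m3 := le_max_left u v
  have m4 := le_max_right u v
  refine ⟨min u v - ε / 2, max u v + δ / 2, by linarith, by linarith, by linarith,
    by linarith, ?_⟩
  intro z hz
  by_cases hz1 : z < min u v
  · apply h1
    rw [Metric.mem_ball, Real.dist_eq, abs_lt]
    constructor <;> linarith [hz.1]
  · by_cases hz2 : max u v < z
    · apply h2
      rw [Metric.mem_ball, Real.dist_eq, abs_lt]
      constructor <;> linarith [hz.2]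
    · exact h z ⟨not_lt.1 hz1, not_lt.1 hz2⟩

/-- `η` fixes `T` and preserves signs of all polynomials with roots only in `T`. -/
structure Pres (T : Set ℝ) (η : ℝ ≃o ℝ) : Prop where
  fix : ∀ z ∈ T, η z = z
  sgn : ∀ r : ℝ[X], (∀ z, r.eval z = 0 → z ∈ T) →
    ∀ z, SignType.sign (r.eval (η z)) = SignType.sign (r.eval z)

lemma Pres.trans {T : Set ℝ} {η θ : ℝ ≃o ℝ} (h : Pres T η) (k : Pres T θ) :
    Pres T (η.trans θ) where
  fix z hz := by
    rw [OrderIso.trans_apply, h.fix z hz, k.fix z hz]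
  sgn r hr z := by
    rw [OrderIso.trans_apply, k.sgn r hr, h.sgn r hr]

lemma Pres.refl (T : Set ℝ) : Pres T (OrderIso.refl ℝ) :=
  ⟨fun _ _ => rfl, fun _ _ _ => rfl⟩

lemma Pres.image {T S : Set ℝ} {φ η : ℝ ≃o ℝ} (hT : T = φ '' S) (h : Pres T η) :
    (φ.trans η) '' S = φ '' S := by
  apply Set.image_congr
  intro s hs
  exact h.fix _ (hT ▸ ⟨s, hs, rfl⟩)

lemma Pres.of_fix {T : Set ℝ} {η : ℝ ≃o ℝ} (a b : ℝ) (h : ∀ z, z ∉ Icc a b → η z = z)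
    (hT : ∀ z ∈ Icc a b, z ∉ T) : Pres T η where
  fix z hz := h z (fun h' => hT z h' hz)
  sgn r hr z := by
    by_cases hz : z ∈ Icc a b
    · have hz' : η z ∈ Icc a b := by
        by_contra hz'
        have := η.injective (h _ hz')
        rw [this] at hz'
        exact hz' hz
      apply sign_const
      intro w hw h0
      exact hT w (Set.OrdConnected.uIcc_subset ordConnected_Icc hz' hz hw) (hr w h0)
    · rw [h z hz]

lemma Good.trans {φ η : ℝ ≃o ℝ} {S : Set ℝ} {p q : ℝ[X]} (h : Good φ S p q)
    (k : Pres (φ '' S) η) : Good (φ.trans η) S p q where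
  fin := h.fin
  degp := h.degp
  degq := h.degq
  root := h.root
  der t := by
    rw [OrderIso.trans_apply, k.sgn q.derivative h.symm.root, h.der t]
  sgn s hs := by
    rw [OrderIso.trans_apply, k.fix _ ⟨s, hs, rfl⟩, h.sgn s hs]

lemma Good.free {φ : ℝ ≃o ℝ} {S : Set ℝ} {c d : ℝ}
    (h : ∀ z ∈ uIcc (φ c) (φ d), z ∉ φ '' S) :
    ∀ z ∈ uIcc c d, z ∉ S := by
  intro z hz hzS
  refine h (φ z) ?_ ⟨z, hzS, rfl⟩
  rw [mem_uIcc] at hz ⊢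
  simpa [φ.le_iff_le] using hz

/-- If all roots of `p` are matched, then signs agree. -/
lemma Good.final {φ : ℝ ≃o ℝ} {S : Set ℝ} {p q : ℝ[X]} (h : Good φ S p q)
    (hr : ∀ c, p.eval c = 0 → q.eval (φ c) = 0) (t : ℝ) :
    SignType.sign (p.eval t) = SignType.sign (q.eval (φ t)) := by
  by_contra hne
  obtain ⟨v, hv, hvz⟩ := h.exists_root t hne
  obtain ⟨w, hw, hwz⟩ := h.symm.exists_root (φ t) (by
    rw [φ.symm_apply_apply]; exact fun h' => hne h'.symm)
  rw [φ.symm_apply_apply] at hwz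
  have him : φ.symm '' (φ '' S) = S := by
    rw [← Set.image_comp]; simp
  rw [him] at hwz
  have hwz' : ∀ z ∈ uIcc (φ t) (φ w), z ∉ φ '' S := by
    apply Good.free (φ := φ.symm)
    rw [him, φ.symm_apply_apply, φ.symm_apply_apply]
    exact hwz
  have hvw : v = φ w := by
    apply root_unique q v (φ w) hv (hr w hw)
    intro z hz h0
    have hmem := h.symm.root z h0
    rcases uIcc_subset_uIcc_union_uIcc (b := φ t) hz with h1 | h1
    · exact hvz z (by rwa [uIcc_comm]) hmem
    · exact hwz' z h1 hmem
  have s1 := sign_of_root p w t hw (fun z hz h0 =>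
    hwz z (by rwa [uIcc_comm]) (h.root z h0))
  have s2 := sign_of_root q (φ w) (φ t) (hr w hw) (fun z hz h0 =>
    hwz' z (by rwa [uIcc_comm]) (h.symm.root z h0))
  apply hne
  rw [s1, s2, h.der t]
  congr 1
  rcases lt_trichotomy w t with h1 | rfl | h1
  · rw [sign_pos (sub_pos.2 h1), sign_pos (sub_pos.2 (φ.lt_iff_lt.2 h1))]
  · simp
  · rw [sign_neg (sub_neg.2 h1), sign_neg (sub_neg.2 (φ.lt_iff_lt.2 h1))]

lemma Good.fix {φ : ℝ ≃o ℝ} {S : Set ℝ} {p q : ℝ[X]} (h : Good φ S p q) :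
    ∃ η : ℝ ≃o ℝ, Pres (φ '' S) η ∧
      ∀ t, SignType.sign (p.eval t) = SignType.sign (q.eval (η (φ t))) := by
  have hp0 : p ≠ 0 := by
    rintro rfl
    simpa using h.degp
  have hfin : ∀ φ : ℝ ≃o ℝ, {c | p.eval c = 0 ∧ q.eval (φ c) ≠ 0}.Finite := by
    intro φ
    refine (p.roots.toFinset.finite_toSet).subset ?_
    intro c hc
    simpa [hp0] using hc.1
  obtain ⟨N, hN⟩ : ∃ N, {c | p.eval c = 0 ∧ q.eval (φ c) ≠ 0}.ncard = N := ⟨_, rfl⟩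
  induction N using Nat.strong_induction_on generalizing φ with
  | _ N ih =>
  by_cases hbad : ∃ c, p.eval c = 0 ∧ q.eval (φ c) ≠ 0
  · obtain ⟨c, hc, hqc⟩ := hbad
    obtain ⟨v, hv, hvz⟩ := h.exists_root c (by
      rw [hc, sign_zero]
      intro h0
      exact hqc (sign_eq_zero_iff.1 h0.symm))
    obtain ⟨a, b, h1, h2, h3, h4, hab⟩ := enlarge _ (h.fin.image φ) _ _ hvz
    obtain ⟨η, hη, hfix⟩ := bump a b (φ c) v h1 h2 h3 h4
    have hP : Pres (φ '' S) η := Pres.of_fix a b hfix hab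
    have hG := h.trans hP
    have hlt : {c | p.eval c = 0 ∧ q.eval ((φ.trans η) c) ≠ 0}.ncard < N := by
      rw [← hN]
      apply Set.ncard_lt_ncard _ (hfin φ)
      rw [Set.ssubset_iff_of_subset]
      · refine ⟨c, ⟨hc, hqc⟩, ?_⟩
        rintro ⟨-, h0⟩
        rw [OrderIso.trans_apply, hη] at h0
        exact h0 hv
      · rintro d ⟨hd, hqd⟩
        refine ⟨hd, fun h0 => hqd ?_⟩
        rw [OrderIso.trans_apply]
        by_cases hdI : φ d ∈ Icc a b
        · exfalso
          have : c = d := by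
            apply root_unique p c d hc hd
            intro z hz hz0
            refine Good.free (φ := φ) (S := S) ?_ z hz (h.root z hz0)
            intro w hw
            exact hab w (Set.OrdConnected.uIcc_subset ordConnected_Icc
              ⟨h1.le, h3.le⟩ hdI hw)
          subst this
          exact hqc h0
        · rw [hfix _ hdI, h0]
    obtain ⟨θ, hθ, hs⟩ := ih _ hlt hG rfl
    rw [hP.image rfl] at hθ
    exact ⟨η.trans θ, hP.trans hθ, hs⟩
  · refine ⟨OrderIso.refl ℝ, Pres.refl _, ?_⟩
    push Not at hbad
    exact h.final hbad

/-- One-step pseudo-remainder. -/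
noncomputable def rem {A : Type*} [CommRing A] (p : A[X]) (n : ℕ) (q : A[X]) (d : ℕ) : A[X] :=
  C (q.coeff d) * p - C (p.coeff n) * X ^ (n - d) * q

lemma rem_natDegree {A : Type*} [CommRing A] (p : A[X]) (n : ℕ) (q : A[X]) (d : ℕ)
    (hn : 1 ≤ n) (hp : p.natDegree ≤ n) (hq : q.natDegree ≤ d) (hd : d ≤ n) :
    (rem p n q d).natDegree < n := by
  have hle : (rem p n q d).natDegree ≤ n - 1 := by
    rw [natDegree_le_iff_coeff_eq_zero]
    intro N hN
    have hN' : n ≤ N := by omega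
    have e : N = (N - (n - d)) + (n - d) := by omega
    have e1 : (C (p.coeff n) * X ^ (n - d) * q).coeff N
        = p.coeff n * q.coeff (N - (n - d)) := by
      rw [mul_assoc, coeff_C_mul, coeff_X_pow_mul', if_pos (by omega)]
    rw [rem, coeff_sub, coeff_C_mul, e1]
    rcases hN'.eq_or_lt with rfl | hlt
    · have : n - (n - d) = d := by omega
      rw [this]; ring
    · have hq' : q.natDegree < N - (n - d) := by omega
      rw [coeff_eq_zero_of_natDegree_lt (hp.trans_lt hlt),
        coeff_eq_zero_of_natDegree_lt hq']
      ring
  omega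

lemma rem_eval {A : Type*} [CommRing A] (x : A →+* ℝ) (p : A[X]) (n : ℕ) (q : A[X]) (d : ℕ)
    (t : ℝ) (ht : (q.map x).eval t = 0) :
    ((rem p n q d).map x).eval t = x (q.coeff d) * (p.map x).eval t := by
  simp [rem, ht]

/-- Two specializations of a family have the same sign diagram. -/
def Equi {A : Type*} [CommRing A] (L : Multiset A[X]) (x y : A →+* ℝ) : Prop :=
  ∃ φ : ℝ ≃o ℝ, ∀ p ∈ L, ∀ t, SignType.sign ((p.map x).eval t) =
    SignType.sign ((p.map y).eval (φ t))

lemma map_eraseLead {A : Type*} [CommRing A] (x : A →+* ℝ) (q : A[X])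
    (h : x q.leadingCoeff = 0) : q.eraseLead.map x = q.map x := by
  have := congrArg (Polynomial.map x) (eraseLead_add_C_mul_X_pow q)
  rw [Polynomial.map_add, Polynomial.map_mul, map_C, h] at this
  simpa using this

lemma dm_step {A : Type*} [CommRing A] (p : A[X]) (L₀ N : Multiset A[X])
    (h : ∀ r ∈ N, r.natDegree < p.natDegree) :
    Multiset.IsDershowitzMannaLT ((L₀ + N).map natDegree) ((p ::ₘ L₀).map natDegree) := by
  refine ⟨L₀.map natDegree, N.map natDegree, {p.natDegree}, by simp, by simp, ?_, ?_⟩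
  · rw [Multiset.map_cons, ← Multiset.singleton_add, add_comm]
  · intro y hy
    obtain ⟨r, hr, rfl⟩ := Multiset.mem_map.1 hy
    exact ⟨_, Multiset.mem_singleton_self _, h r hr⟩

lemma sign_cancel {a b c d : ℝ} (h : SignType.sign (a * b) = SignType.sign (c * d))
    (hac : SignType.sign a = SignType.sign c) (ha : a ≠ 0) :
    SignType.sign b = SignType.sign d := by
  rw [sign_mul, sign_mul, ← hac] at h
  have : SignType.sign a ≠ 0 := by rwa [Ne, sign_eq_zero_iff]
  revert this h
  generalize SignType.sign a = s
  generalize SignType.sign b = t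
  generalize SignType.sign d = u
  revert s t u
  decide

lemma sign_zero_iff_of {a b : ℝ} (h : SignType.sign a = SignType.sign b) :
    a = 0 ↔ b = 0 := by
  rw [← sign_eq_zero_iff, h, sign_eq_zero_iff]

/-- Generic step. -/
lemma equi_step {A : Type*} [CommRing A] (x y : A →+* ℝ) (p : A[X]) (L₀ : Multiset A[X])
    (hp : 1 ≤ p.natDegree)
    (hxp : x p.leadingCoeff ≠ 0)
    (hlc : ∀ q ∈ p ::ₘ L₀,
      SignType.sign (x q.leadingCoeff) = SignType.sign (y q.leadingCoeff))
    (hnz : ∀ q ∈ L₀, 1 ≤ q.natDegree → x q.leadingCoeff ≠ 0)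
    (h : Equi (L₀ + (derivative p ::ₘ rem p p.natDegree (derivative p) (p.natDegree - 1) ::ₘ
      L₀.map (fun q => rem p p.natDegree q q.natDegree))) x y) :
    Equi (p ::ₘ L₀) x y := by
  obtain ⟨φ, hφ⟩ := h
  have hL : ∀ q ∈ L₀, ∀ t, SignType.sign ((q.map x).eval t) =
      SignType.sign ((q.map y).eval (φ t)) := fun q hq => hφ q (by simp [hq])
  have hD : ∀ t, SignType.sign (((derivative p).map x).eval t) =
      SignType.sign (((derivative p).map y).eval (φ t)) := hφ _ (by simp)
  have hR : ∀ t, SignType.sign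
      (((rem p p.natDegree (derivative p) (p.natDegree - 1)).map x).eval t) =
      SignType.sign
      (((rem p p.natDegree (derivative p) (p.natDegree - 1)).map y).eval (φ t)) :=
    hφ _ (by simp)
  have hQ : ∀ q ∈ L₀, ∀ t, SignType.sign
      (((rem p p.natDegree q q.natDegree).map x).eval t) =
      SignType.sign (((rem p p.natDegree q q.natDegree).map y).eval (φ t)) := by
    intro q hq
    apply hφ
    simp only [Multiset.mem_add, Multiset.mem_cons, Multiset.mem_map]
    exact Or.inr (Or.inr (Or.inr ⟨q, hq, rfl⟩))
  have hyp : y p.leadingCoeff ≠ 0 := fun h0 =>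
    hxp ((sign_zero_iff_of (hlc p (by simp))).2 h0)
  have hdx : (p.map x).natDegree = p.natDegree := natDegree_map_of_leadingCoeff_ne_zero x hxp
  have hdy : (p.map y).natDegree = p.natDegree := natDegree_map_of_leadingCoeff_ne_zero y hyp
  let S : Set ℝ := {t | ((derivative p).map x).eval t = 0 ∨
    ∃ q ∈ L₀, 1 ≤ q.natDegree ∧ (q.map x).eval t = 0}
  have hdne : (derivative p).map x ≠ 0 := by
    rw [← derivative_map]
    intro h0
    have := derivative_eq_zero.1 h0
    omega
  have hfin : S.Finite := by
    classical
    have : S ⊆ (((derivative p).map x).roots.toFinset : Set ℝ) ∪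
        ⋃ q ∈ L₀.toFinset, ((q.map x).roots.toFinset : Set ℝ) := by
      rintro t (ht | ⟨q, hq, hq1, ht⟩)
      · left
        simpa [hdne] using ht
      · right
        have hne : q.map x ≠ 0 := by
          intro h0
          have := congrArg (fun r => r.coeff q.natDegree) h0
          simp only [coeff_map, coeff_zero] at this
          exact hnz q hq hq1 this
        simp only [mem_iUnion]
        refine ⟨q, by simpa using hq, ?_⟩
        simpa [hne] using ht
    refine Set.Finite.subset (Set.Finite.union (Finset.finite_toSet _) ?_) this
    exact Set.Finite.biUnion (Finset.finite_toSet _) (fun q _ => Finset.finite_toSet _)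
  have hG : Good φ S (p.map x) (p.map y) := by
    refine ⟨hfin, ?_, ?_, ?_, ?_, ?_⟩
    · rw [← natDegree_pos_iff_degree_pos]; omega
    · rw [← natDegree_pos_iff_degree_pos]; omega
    · intro t ht
      left
      rwa [derivative_map] at ht
    · intro t
      rw [derivative_map, derivative_map]
      exact hD t
    · rintro s (hs | ⟨q, hq, hq1, hs⟩)
      · have hs' := (sign_zero_iff_of (hD s)).1 hs
        have := hR s
        rw [rem_eval x _ _ _ _ _ hs, rem_eval y _ _ _ _ _ hs'] at this
        have e : (derivative p).coeff (p.natDegree - 1) = p.leadingCoeff * p.natDegree := by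
          rw [coeff_derivative, Nat.sub_add_cancel hp, leadingCoeff, Nat.cast_sub hp]
          simp
        have hn : (0 : ℝ) < p.natDegree := by exact_mod_cast hp
        refine sign_cancel this ?_ ?_
        · rw [e, map_mul x, map_mul y, map_natCast x, map_natCast y, sign_mul, sign_mul,
            hlc p (by simp)]
        · rw [e, map_mul, map_natCast]
          exact mul_ne_zero hxp hn.ne'
      · have hs' := (sign_zero_iff_of (hL q hq s)).1 hs
        have := hQ q hq s
        rw [rem_eval x _ _ _ _ _ hs, rem_eval y _ _ _ _ _ hs'] at this
        exact sign_cancel this (hlc q (by simp [hq])) (hnz q hq hq1)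
  obtain ⟨η, hη, hs⟩ := hG.fix
  refine ⟨φ.trans η, ?_⟩
  intro q hq t
  rcases Multiset.mem_cons.1 hq with rfl | hq
  · exact hs t
  · rw [OrderIso.trans_apply, hL q hq t]
    by_cases hq1 : 1 ≤ q.natDegree
    · rw [hη.sgn (q.map y)]
      intro z hz
      refine ⟨φ.symm z, Or.inr ⟨q, hq, hq1, ?_⟩, φ.apply_symm_apply z⟩
      rw [sign_zero_iff_of (hL q hq _), φ.apply_symm_apply]
      exact hz
    · rw [eq_C_of_natDegree_eq_zero (p := q) (by omega)]
      simp

theorem elim_one {A : Type*} [CommRing A] (L : Multiset A[X]) :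
    ∃ F : Finset A, ∀ x y : A →+* ℝ,
      (∀ a ∈ F, SignType.sign (x a) = SignType.sign (y a)) → Equi L x y := by
  classical
  induction L using (InvImage.wf (fun L : Multiset A[X] => L.map natDegree)
    Multiset.wellFounded_isDershowitzMannaLT).induction with
  | _ L ih =>
  by_cases h0 : ∃ p ∈ L, 1 ≤ p.natDegree
  · obtain ⟨p, hp, hmax⟩ : ∃ p ∈ L, ∀ q ∈ L, q.natDegree ≤ p.natDegree := by
      obtain ⟨p, hp, hm⟩ := Finset.exists_max_image L.toFinset natDegree (by
        obtain ⟨p, hp, -⟩ := h0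
        exact ⟨p, by simpa using hp⟩)
      exact ⟨p, by simpa using hp, fun q hq => hm q (by simpa using hq)⟩
    have hp1 : 1 ≤ p.natDegree := by
      obtain ⟨q, hq, hq1⟩ := h0
      exact hq1.trans (hmax q hq)
    obtain ⟨L₀, rfl⟩ := Multiset.exists_cons_of_mem hp
    obtain ⟨F', hF'⟩ := ih (L₀ + (derivative p ::ₘ
        rem p p.natDegree (derivative p) (p.natDegree - 1) ::ₘ
        L₀.map (fun q => rem p p.natDegree q q.natDegree))) (by
      apply dm_step
      intro r hr
      simp only [Multiset.mem_cons, Multiset.mem_map] at hr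
      rcases hr with rfl | rfl | ⟨q, hq, rfl⟩
      · exact natDegree_derivative_lt (by omega)
      · exact rem_natDegree _ _ _ _ hp1 le_rfl (natDegree_derivative_le p) (by omega)
      · exact rem_natDegree _ _ _ _ hp1 le_rfl le_rfl (hmax q (by simp [hq])))
    have hE : ∀ q : A[X], ∃ F : Finset A, q ∈ p ::ₘ L₀ → 1 ≤ q.natDegree →
        ∀ x y : A →+* ℝ, (∀ a ∈ F, SignType.sign (x a) = SignType.sign (y a)) →
          Equi ((p ::ₘ L₀).erase q + {q.eraseLead}) x y := by
      intro q
      by_cases hq : q ∈ p ::ₘ L₀ ∧ 1 ≤ q.natDegree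
      · obtain ⟨F, hF⟩ := ih ((p ::ₘ L₀).erase q + {q.eraseLead}) (by
          have := dm_step q ((p ::ₘ L₀).erase q) {q.eraseLead} (by
            intro r hr
            rw [Multiset.mem_singleton] at hr
            subst hr
            have := eraseLead_natDegree_le q
            omega)
          rw [Multiset.cons_erase hq.1] at this
          exact this)
        exact ⟨F, fun _ _ => hF⟩
      · exact ⟨∅, fun h1 h2 => absurd ⟨h1, h2⟩ hq⟩
    choose E hE using hE
    refine ⟨F' ∪ (p ::ₘ L₀).toFinset.biUnion E ∪ (p ::ₘ L₀).toFinset.image leadingCoeff, ?_⟩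
    intro x y hxy
    have hlc : ∀ q ∈ p ::ₘ L₀,
        SignType.sign (x q.leadingCoeff) = SignType.sign (y q.leadingCoeff) := by
      intro q hq
      apply hxy
      refine Finset.mem_union_right _ (Finset.mem_image.2 ⟨q, ?_, rfl⟩)
      rwa [Multiset.mem_toFinset]
    by_cases hz : ∃ q ∈ p ::ₘ L₀, 1 ≤ q.natDegree ∧ x q.leadingCoeff = 0
    · obtain ⟨q, hq, hq1, hq0⟩ := hz
      have hq0' := (sign_zero_iff_of (hlc q hq)).1 hq0
      obtain ⟨φ, hφ⟩ := hE q hq hq1 x y (by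
        intro a ha
        apply hxy
        refine Finset.mem_union_left _ (Finset.mem_union_right _
          (Finset.mem_biUnion.2 ⟨q, ?_, ha⟩))
        rwa [Multiset.mem_toFinset])
      refine ⟨φ, ?_⟩
      intro r hr t
      by_cases hrq : r = q
      · subst hrq
        have := hφ r.eraseLead (by simp) t
        rwa [map_eraseLead x r hq0, map_eraseLead y r hq0'] at this
      · apply hφ
        rw [Multiset.mem_add]
        left
        exact (Multiset.mem_erase_of_ne hrq).2 hr
    · push Not at hz
      apply equi_step x y p L₀ hp1 (hz p (by simp) hp1) hlc
        (fun q hq => hz q (by simp [hq]))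
      apply hF'
      intro a ha
      exact hxy a (Finset.mem_union_left _ (Finset.mem_union_left _ ha))
  · push Not at h0
    refine ⟨L.toFinset.image (fun p => p.coeff 0), ?_⟩
    intro x y hxy
    refine ⟨OrderIso.refl ℝ, ?_⟩
    intro p hp t
    have := hxy (p.coeff 0) (Finset.mem_image.2 ⟨p, by simpa using hp, rfl⟩)
    have h1 := h0 p hp
    rw [eq_C_of_natDegree_eq_zero (p := p) (by omega)]
    simpa using this

theorem elim_many (n : ℕ) {A : Type*} [CommRing A] (G : Finset (MvPolynomial (Fin n) A)) :
    ∃ F : Finset A, ∀ x y : A →+* ℝ,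
      (∀ a ∈ F, SignType.sign (x a) = SignType.sign (y a)) →
      ∀ t : Fin n → ℝ, ∃ t' : Fin n → ℝ, ∀ g ∈ G,
        SignType.sign (MvPolynomial.eval₂Hom x t g) =
          SignType.sign (MvPolynomial.eval₂Hom y t' g) := by
  classical
  induction n with
  | zero =>
    refine ⟨G.image (fun g => g.coeff 0), ?_⟩
    intro x y hxy t
    refine ⟨t, ?_⟩
    intro g hg
    have := hxy _ (Finset.mem_image.2 ⟨g, hg, rfl⟩)
    rw [MvPolynomial.eq_C_of_isEmpty g]
    simpa using this
  | succ n ih =>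
    obtain ⟨F', hF'⟩ := elim_one (G.val.map (MvPolynomial.finSuccEquiv A n))
    obtain ⟨F, hF⟩ := ih F'
    refine ⟨F, ?_⟩
    intro x y hxy t
    obtain ⟨t', ht'⟩ := hF x y hxy (fun i => t i.succ)
    obtain ⟨φ, hφ⟩ := hF' _ _ ht'
    refine ⟨Fin.cons (φ (t 0)) t', ?_⟩
    have key : ∀ (x : A →+* ℝ) (s : ℝ) (t : Fin n → ℝ) (g : MvPolynomial (Fin (n + 1)) A),
        MvPolynomial.eval₂Hom x (Fin.cons s t : Fin (n + 1) → ℝ) g =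
        ((MvPolynomial.finSuccEquiv A n g).map (MvPolynomial.eval₂Hom x t)).eval s := by
      intro x s t g
      have : MvPolynomial.eval₂Hom x (Fin.cons s t : Fin (n + 1) → ℝ) =
          ((evalRingHom s).comp (mapRingHom (MvPolynomial.eval₂Hom x t))).comp
            (MvPolynomial.finSuccEquiv A n : _ →+* _) := by
        apply MvPolynomial.ringHom_ext
        · intro a
          simp [MvPolynomial.finSuccEquiv_apply]
        · intro i
          refine Fin.cases ?_ (fun j => ?_) i
          · simp [MvPolynomial.finSuccEquiv_X_zero]
          · simp [MvPolynomial.finSuccEquiv_X_succ]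
      rw [this]
      rfl
    intro g hg
    have := hφ _ (Multiset.mem_map.2 ⟨g, hg, rfl⟩) (t 0)
    rw [← key, ← key] at this
    rw [← this]
    congr 3
    exact (Fin.cons_self_tail t).symm

/-- Sets determined by the signs of finitely many polynomials. -/
def Det {k : ℕ} (s : Set (Fin k → ℝ)) : Prop :=
  ∃ G : Finset (MvPolynomial (Fin k) ℝ), ∀ x y : Fin k → ℝ,
    (∀ g ∈ G, SignType.sign (MvPolynomial.eval x g) = SignType.sign (MvPolynomial.eval y g)) →
    x ∈ s → y ∈ s

lemma det_of_semi {k : ℕ} {s : Set (Fin k → ℝ)} (h : IsSemialgebraic s) : Det s := by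
  classical
  induction h with
  | basic g =>
    refine ⟨{g}, ?_⟩
    intro x y h hx
    have := h g (by simp)
    rw [mem_ofPred_eq] at hx ⊢
    rw [sign_pos hx] at this
    exact sign_eq_one_iff.1 this.symm
  | compl _ ih =>
    obtain ⟨G, hG⟩ := ih
    exact ⟨G, fun x y h hx hy => hx (hG y x (fun g hg => (h g hg).symm) hy)⟩
  | union _ _ ih1 ih2 =>
    obtain ⟨G, hG⟩ := ih1
    obtain ⟨H, hH⟩ := ih2
    refine ⟨G ∪ H, fun x y h hx => ?_⟩
    rcases hx with hx | hx
    · exact Or.inl (hG x y (fun g hg => h g (Finset.mem_union_left _ hg)) hx)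
    · exact Or.inr (hH x y (fun g hg => h g (Finset.mem_union_right _ hg)) hx)

lemma semi_inter {k : ℕ} {s t : Set (Fin k → ℝ)} (hs : IsSemialgebraic s)
    (ht : IsSemialgebraic t) : IsSemialgebraic (s ∩ t) := by
  have := (hs.compl.union ht.compl).compl
  rwa [compl_union, compl_compl, compl_compl] at this

lemma semi_empty {k : ℕ} : IsSemialgebraic (∅ : Set (Fin k → ℝ)) := by
  have := IsSemialgebraic.basic (0 : MvPolynomial (Fin k) ℝ)
  simpa using this

lemma semi_univ {k : ℕ} : IsSemialgebraic (univ : Set (Fin k → ℝ)) := by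
  have := (semi_empty (k := k)).compl
  rwa [compl_empty] at this

lemma semi_sign {k : ℕ} (g : MvPolynomial (Fin k) ℝ) (e : SignType) :
    IsSemialgebraic {x | SignType.sign (MvPolynomial.eval x g) = e} := by
  have h1 : IsSemialgebraic {x | SignType.sign (MvPolynomial.eval x g) = 1} := by
    simpa only [sign_eq_one_iff] using IsSemialgebraic.basic g
  have h2 : IsSemialgebraic {x | SignType.sign (MvPolynomial.eval x g) = -1} := by
    have := IsSemialgebraic.basic (-g)
    simpa only [sign_eq_neg_one_iff, map_neg, Left.neg_pos_iff] using this
  cases e with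
  | pos => exact h1
  | neg => exact h2
  | zero =>
    have := (h1.union h2).compl
    convert this using 1
    ext x
    simp only [mem_ofPred_eq, mem_compl_iff, mem_union]
    generalize SignType.sign (MvPolynomial.eval x g) = s
    revert s
    decide

lemma semi_biUnion {k : ℕ} {ι : Type*} (I : Finset ι) (f : ι → Set (Fin k → ℝ))
    (h : ∀ i ∈ I, IsSemialgebraic (f i)) : IsSemialgebraic (⋃ i ∈ I, f i) := by
  classical
  induction I using Finset.induction_on with
  | empty => simpa using semi_empty
  | insert a I _ ih =>
    rw [Finset.set_biUnion_insert]
    exact (h a (by simp)).union (ih (fun i hi => h i (by simp [hi])))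

lemma semi_biInter {k : ℕ} {ι : Type*} (I : Finset ι) (f : ι → Set (Fin k → ℝ))
    (h : ∀ i ∈ I, IsSemialgebraic (f i)) : IsSemialgebraic (⋂ i ∈ I, f i) := by
  classical
  induction I using Finset.induction_on with
  | empty => simpa using semi_univ
  | insert a I _ ih =>
    rw [Finset.set_biInter_insert]
    exact semi_inter (h a (by simp)) (ih (fun i hi => h i (by simp [hi])))

lemma semi_of_det {k : ℕ} {s : Set (Fin k → ℝ)} (h : Det s) : IsSemialgebraic s := by
  classical
  obtain ⟨G, hG⟩ := h
  let sg : (Fin k → ℝ) → (G → SignType) := fun x g => SignType.sign (MvPolynomial.eval x g.1)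
  let I : Finset (G → SignType) := Finset.univ.filter (fun e => ∃ x ∈ s, sg x = e)
  have : s = ⋃ e ∈ I, ⋂ g ∈ (Finset.univ : Finset G),
      {x | SignType.sign (MvPolynomial.eval x g.1) = e g} := by
    ext x
    simp only [mem_iUnion, mem_iInter, mem_ofPred_eq]
    constructor
    · intro hx
      exact ⟨sg x, by simp only [I, Finset.mem_filter]; exact ⟨Finset.mem_univ _, x, hx, rfl⟩,
        fun g _ => rfl⟩
    · rintro ⟨e, he, hx⟩
      obtain ⟨-, y, hy, rfl⟩ := Finset.mem_filter.1 he
      exact hG y x (fun g hg => (hx ⟨g, hg⟩ (Finset.mem_univ _)).symm) hy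
  rw [this]
  apply semi_biUnion
  intro e _
  apply semi_biInter
  intro g _
  exact semi_sign g.1 (e g)

end TS

/-- Tarski–Seidenberg: the image of a semialgebraic set under a polynomial map is
semialgebraic. -/
theorem isSemialgebraic_image_polynomialMap (n m : ℕ)
    (f : (Fin n → ℝ) → (Fin m → ℝ)) (F : Fin m → MvPolynomial (Fin n) ℝ)
    (hf : ∀ (x : Fin n → ℝ) (i : Fin m), f x i = MvPolynomial.eval x (F i))
    (V : Set (Fin n → ℝ)) (hV : IsSemialgebraic V) :
    IsSemialgebraic (f '' V) := by
  classical
  obtain ⟨G, hG⟩ := TS.det_of_semi hV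
  let ι : MvPolynomial (Fin n) ℝ →+* MvPolynomial (Fin n) (MvPolynomial (Fin m) ℝ) :=
    MvPolynomial.map MvPolynomial.C
  have hι : ∀ (y : Fin m → ℝ) (t : Fin n → ℝ) (g : MvPolynomial (Fin n) ℝ),
      MvPolynomial.eval₂Hom (MvPolynomial.eval y) t (ι g) = MvPolynomial.eval t g := by
    intro y t g
    have : (MvPolynomial.eval₂Hom (MvPolynomial.eval y) t).comp ι = MvPolynomial.eval t := by
      apply MvPolynomial.ringHom_ext
      · intro a
        simp [ι]
      · intro i
        simp [ι]
    rw [← this]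
    rfl
  obtain ⟨H, hH⟩ := TS.elim_many n (G.image ι ∪
    Finset.univ.image (fun i => ι (F i) - MvPolynomial.C (MvPolynomial.X i)))
  apply TS.semi_of_det
  refine ⟨H, ?_⟩
  rintro y y' hyy ⟨t, ht, rfl⟩
  obtain ⟨t', ht'⟩ := hH (MvPolynomial.eval (f t)) (MvPolynomial.eval y') hyy t
  refine ⟨t', hG t t' ?_ ht, ?_⟩
  · intro g hg
    have := ht' (ι g) (Finset.mem_union_left _ (Finset.mem_image_of_mem _ hg))
    rwa [hι, hι] at this
  · funext i
    have := ht' _ (Finset.mem_union_right _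
      (Finset.mem_image_of_mem _ (Finset.mem_univ i)))
    rw [map_sub (MvPolynomial.eval₂Hom _ t), map_sub (MvPolynomial.eval₂Hom _ t'), hι, hι] at this
    have h2 := (TS.sign_zero_iff_of this).1 (by simp [hf])
    rw [hf]
    simpa [sub_eq_zero] using h2
end
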